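/- arXiv:1201.1546 — 4 statements merged into one kernel-verified Lean document; each statement's English description precedes it below -/
import Mathlib

section
/- Let 1 ≤ d ≤ 4 and let M, N ∈ S_d^+ be such that d_×(M,N) < ln(1 + κ(M)^{−2})/4. Let (u_1,…,u_d) be an M-reduced basis of ℤ^d and let 𝒯 be an N-reduced mesh. Then u_1,…,u_d and −u_1,…,−u_d are all vertices of 𝒯. -/
open Matrix
open scoped BigOperators ENNReal Classical

noncomputable section

/-- Euclidean norm of a vector of `ℝ^d`. -/
def euclNorm {d : ℕ} (u : Fin d → ℝ) : ℝ := Real.sqrt (u ⬝ᵥ u)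

/-- The norm `‖u‖_M := √(uᵀ M u)` associated to a matrix `M`. -/
def normM {d : ℕ} (M : Matrix (Fin d) (Fin d) ℝ) (u : Fin d → ℝ) : ℝ :=
  Real.sqrt (u ⬝ᵥ M.mulVec u)

/-- Operator norm of a matrix, with respect to the euclidean norm. -/
def opNorm {d : ℕ} (M : Matrix (Fin d) (Fin d) ℝ) : ℝ :=
  sSup {r : ℝ | ∃ u : Fin d → ℝ, euclNorm u = 1 ∧ r = euclNorm (M.mulVec u)}

/-- Anisotropy ratio `κ(M) := max ‖u‖_M/‖v‖_M` over euclidean-unit vectors `u, v`. -/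
def kappa {d : ℕ} (M : Matrix (Fin d) (Fin d) ℝ) : ℝ :=
  sSup {r : ℝ | ∃ u v : Fin d → ℝ,
    euclNorm u = 1 ∧ euclNorm v = 1 ∧ r = normM M u / normM M v}

/-- `z` has integer coordinates, i.e. `z ∈ ℤ^d`. -/
def IsIntVec {d : ℕ} (z : Fin d → ℝ) : Prop := ∀ i, ∃ m : ℤ, z i = (m : ℝ)

/-- `z` belongs to the sub-lattice `u_0 ℤ + ⋯ + u_{k-1} ℤ` generated by the
first `k` vectors of the family `u`. -/
def InLatticeSpan {d : ℕ} (u : Fin d → Fin d → ℝ) (k : ℕ) (z : Fin d → ℝ) : Prop :=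
  ∃ c : Fin d → ℤ, (∀ i : Fin d, ¬ ((i : ℕ) < k) → c i = 0) ∧ z = ∑ i, (c i : ℝ) • u i

/-- `u` is an `M`-reduced basis of `ℤ^d`: a basis of the lattice `ℤ^d`
(integer entries, determinant `±1`) such that each `u k` minimizes `‖·‖_M`
among integer vectors outside the sub-lattice spanned by `u 0, …, u (k-1)`. -/
def IsReducedBasis {d : ℕ} (M : Matrix (Fin d) (Fin d) ℝ) (u : Fin d → Fin d → ℝ) : Prop :=
  (∀ i, IsIntVec (u i)) ∧ |(Matrix.of u).det| = 1 ∧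
  ∀ k : Fin d, ∀ z : Fin d → ℝ, IsIntVec z → ¬ InLatticeSpan u (k : ℕ) z →
    normM M (u k) ≤ normM M z

/-- A simplex of `ℝ^d`, described by its vertex set: `d+1` affinely independent points. -/
def IsSimplex (d : ℕ) (V : Finset (Fin d → ℝ)) : Prop :=
  V.card = d + 1 ∧ AffineIndependent ℝ (fun v : V => (v : Fin d → ℝ))

/-- A (conforming) mesh: a finite collection of simplices such that the intersection
of any two of them is the convex hull of their common vertices. -/
def IsMesh (d : ℕ) (𝒯 : Finset (Finset (Fin d → ℝ))) : Prop :=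
  (∀ V ∈ 𝒯, IsSimplex d V) ∧
  ∀ S ∈ 𝒯, ∀ T ∈ 𝒯,
    (convexHull ℝ (S : Set (Fin d → ℝ))) ∩ (convexHull ℝ (T : Set (Fin d → ℝ)))
      = convexHull ℝ ((S ∩ T : Finset (Fin d → ℝ)) : Set (Fin d → ℝ))

/-- An `M`-reduced mesh. -/
def IsReducedMesh {d : ℕ} (M : Matrix (Fin d) (Fin d) ℝ)
    (𝒯 : Finset (Finset (Fin d → ℝ))) : Prop :=
  IsMesh d 𝒯 ∧
  (⋃ V ∈ 𝒯, convexHull ℝ (V : Set (Fin d → ℝ))) ∈ nhds (0 : Fin d → ℝ) ∧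
  (∀ V ∈ 𝒯, ∀ v ∈ V, IsIntVec v) ∧
  (∀ V ∈ 𝒯, MeasureTheory.volume (convexHull ℝ (V : Set (Fin d → ℝ)))
      = ENNReal.ofReal (1 / (Nat.factorial d))) ∧
  (∀ V ∈ 𝒯, (0 : Fin d → ℝ) ∈ V) ∧
  (∀ V ∈ 𝒯, ∀ v ∈ V, ∀ w ∈ V, v ≠ 0 → w ≠ 0 → 0 ≤ v ⬝ᵥ M.mulVec w)

/-- `z` is a vertex of the mesh `𝒯`. -/
def IsMeshVertex {d : ℕ} (𝒯 : Finset (Finset (Fin d → ℝ))) (z : Fin d → ℝ) : Prop :=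
  ∃ V ∈ 𝒯, z ∈ V

/-- The multiplicative distance `d_×(M,N) := sup_{u ≠ 0} |ln ‖u‖_M − ln ‖u‖_N|`. -/
def dTimes {d : ℕ} (M N : Matrix (Fin d) (Fin d) ℝ) : ℝ :=
  sSup {r : ℝ | ∃ u : Fin d → ℝ, u ≠ 0 ∧ r = |Real.log (normM M u) - Real.log (normM N u)|}

/-- The periodic unit box `Ω = (ℝ/ℤ)^d`. -/
abbrev Torus (d : ℕ) : Type := Fin d → AddCircle (1 : ℝ)

/-- Canonical projection `ℝ^d → (ℝ/ℤ)^d`. -/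
def toTorus {d : ℕ} (x : Fin d → ℝ) : Torus d := fun i => (x i : AddCircle (1 : ℝ))

/-- The grid `Ω_n = {0, 1/n, …, (n-1)/n}^d ⊂ Ω`. -/
def IsGridPoint {d : ℕ} (n : ℕ) (z : Torus d) : Prop :=
  ∃ k : Fin d → ℤ, ∀ i, z i = (((k i : ℝ) / (n : ℝ) : ℝ) : AddCircle (1 : ℝ))

/-- The quotient (periodic) distance on the torus. -/
def dPer {d : ℕ} (z x : Torus d) : ℝ :=
  sInf {r : ℝ | ∃ Z X : Fin d → ℝ, toTorus Z = z ∧ toTorus X = x ∧ r = euclNorm (Z - X)}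

/-- The Hopf–Lax update operator associated to the matrix `M`, the stencil (mesh) `𝒯`,
and the grid scale `1/n`: minimum over simplices `T ∈ 𝒯`, and over barycentric
coefficients `α ≥ 0` supported on the nonzero vertices of `T` with total mass 1, of
`‖∑ α_v v/n‖_M + ∑ α_v u(z + v/n)` (with the convention `0·∞ = 0`). -/
def hopfLax {d : ℕ} (M : Matrix (Fin d) (Fin d) ℝ) (𝒯 : Finset (Finset (Fin d → ℝ)))
    (n : ℕ) (u : Torus d → ℝ≥0∞) (z : Torus d) : ℝ≥0∞ :=
  ⨅ (T : Finset (Fin d → ℝ)) (_ : T ∈ 𝒯) (α : (Fin d → ℝ) → ℝ)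
    (_ : ∀ w, 0 ≤ α w) (_ : α 0 = 0) (_ : ∑ w ∈ T, α w = 1),
    ENNReal.ofReal (normM M ((n : ℝ)⁻¹ • ∑ w ∈ T, α w • w)) +
      ∑ w ∈ T, ENNReal.ofReal (α w) * u (z + toTorus ((n : ℝ)⁻¹ • w))

/-- `u` solves the discrete fixed point system: `u(0) = 0` and
`u(z) = Λ_n(u,z)` at every other grid point `z`. -/
def SolvesDiscrete {d : ℕ} (𝓜 : Torus d → Matrix (Fin d) (Fin d) ℝ)
    (𝒯 : Torus d → Finset (Finset (Fin d → ℝ))) (n : ℕ) (u : Torus d → ℝ≥0∞) : Prop :=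
  u 0 = 0 ∧ ∀ z : Torus d, IsGridPoint n z → z ≠ 0 → u z = hopfLax (𝓜 z) (𝒯 z) n u z


open MeasureTheory in
theorem stdS_vol (d : ℕ) : ENNReal.ofReal (1 / (Nat.factorial d)) ≤
    volume {x : Fin d → ℝ | (∀ i, 0 ≤ x i) ∧ ∑ i, x i ≤ 1} := by
  set S := {x : Fin d → ℝ | (∀ i, 0 ≤ x i) ∧ ∑ i, x i ≤ 1} with hS
  let f : (Fin d → Bool) → ((Fin d → ℝ) →ₗ[ℝ] (Fin d → ℝ)) := fun s =>
    Matrix.toLin' (Matrix.diagonal (fun i => if s i then (1:ℝ) else -1))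
  have hdet : ∀ s, |LinearMap.det (f s)| = 1 := by
    intro s
    simp only [f, LinearMap.det_toLin', Matrix.det_diagonal, Finset.abs_prod]
    apply Finset.prod_eq_one
    intro i _
    split_ifs <;> simp
  have hcov : {x : Fin d → ℝ | ∑ i, |x i| ^ (1:ℝ) < 1} ⊆ ⋃ s, (f s) ⁻¹' S := by
    intro x hx
    simp only [Real.rpow_one, Set.mem_ofPred_eq] at hx
    rw [Set.mem_iUnion]
    refine ⟨fun i => decide (0 ≤ x i), ?_⟩
    have : f (fun i => decide (0 ≤ x i)) x = fun i => |x i| := by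
      ext i
      simp only [f, Matrix.toLin'_apply, Matrix.mulVec_diagonal]
      by_cases h : 0 ≤ x i
      · simp [h, abs_of_nonneg]
      · simp [h, abs_of_neg (not_le.1 h)]
    rw [Set.mem_preimage, this]
    exact ⟨fun i => abs_nonneg _, hx.le⟩
  have h1 := measure_mono (μ := volume) hcov
  rw [volume_sum_rpow_lt_one (Fin d) (le_refl 1)] at h1
  have h2 := h1.trans (measure_iUnion_le _)
  have h3 : ∀ s, volume ((f s) ⁻¹' S) = volume S := by
    intro s
    rw [Measure.addHaar_preimage_linearMap volume (by intro h; have := hdet s; rw [h] at this; simp at this), abs_inv, hdet s]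
    simp
  simp only [h3, tsum_fintype, Finset.sum_const, Finset.card_univ, Fintype.card_fun,
    Fintype.card_bool, Fintype.card_fin, nsmul_eq_mul] at h2
  have e1 : (2 * Real.Gamma (1 / 1 + 1)) ^ d / Real.Gamma ((d:ℝ) / 1 + 1) = 2 ^ d * (1 / (Nat.factorial d : ℝ)) := by
    rw [div_one, div_one, Real.Gamma_nat_eq_factorial]
    have : Real.Gamma (1+1) = 1 := by
      have := Real.Gamma_nat_eq_factorial 1
      simpa using this
    rw [this]; ring
  rw [e1, ENNReal.ofReal_mul (by positivity)] at h2
  have e2 : ENNReal.ofReal ((2:ℝ)^d) = ((2^d : ℕ) : ℝ≥0∞) := by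
    rw [← ENNReal.ofReal_natCast]; norm_cast
  rw [e2] at h2
  exact (ENNReal.mul_le_mul_iff_right (by simp) (by simp)).1 h2

open MeasureTheory in
theorem stdS_vol_lt_top (d : ℕ) :
    volume {x : Fin d → ℝ | (∀ i, 0 ≤ x i) ∧ ∑ i, x i ≤ 1} ≠ ⊤ := by
  apply ne_of_lt
  refine lt_of_le_of_lt (measure_mono (t := Set.Icc 0 1) ?_) ?_
  · rintro x ⟨h0, h1⟩
    refine ⟨fun i => h0 i, fun i => ?_⟩
    exact (Finset.single_le_sum (fun j _ => h0 j) (Finset.mem_univ i)).trans h1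
  · exact isCompact_Icc.measure_lt_top

open MeasureTheory in
theorem det_le_one {d : ℕ} (V : Finset (Fin d → ℝ)) (h0 : (0 : Fin d → ℝ) ∈ V)
    (v : Fin d → Fin d → ℝ) (hv : ∀ i, v i ∈ V)
    (hvol : volume (convexHull ℝ (V : Set (Fin d → ℝ)))
      = ENNReal.ofReal (1 / (Nat.factorial d))) :
    |((Matrix.of v)ᵀ).det| ≤ 1 := by
  set S := {x : Fin d → ℝ | (∀ i, 0 ≤ x i) ∧ ∑ i, x i ≤ 1} with hS
  have hsub : (Matrix.toLin' (Matrix.of v)ᵀ) '' S ⊆ convexHull ℝ (V : Set (Fin d → ℝ)) := by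
    rintro _ ⟨x, ⟨hx0, hx1⟩, rfl⟩
    have hc : Convex ℝ (convexHull ℝ (V : Set (Fin d → ℝ))) := convex_convexHull ℝ _
    have := hc.sum_mem (t := (Finset.univ : Finset (Option (Fin d))))
      (w := fun o => o.elim (1 - ∑ i, x i) x) (z := fun o => o.elim 0 v)
      (by rintro (_ | i) _
          · simpa using hx1
          · exact hx0 i)
      (by simp [Fintype.sum_option])
      (by rintro (_ | i) _
          · exact subset_convexHull ℝ _ h0
          · exact subset_convexHull ℝ _ (hv i))
    convert this using 1
    ext j
    simp [Fintype.sum_option, Matrix.toLin'_apply, Matrix.mulVec, dotProduct, mul_comm]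
  have h1 := measure_mono (μ := volume) hsub
  rw [Measure.addHaar_image_linearMap, hvol, LinearMap.det_toLin'] at h1
  have h2 := h1.trans (stdS_vol d)
  have hpos : volume S ≠ 0 := by
    have := stdS_vol d
    intro h
    rw [← hS, h] at this
    have h3 : (0:ℝ) < 1 / (Nat.factorial d) := by positivity
    have := ENNReal.ofReal_pos.2 h3
    simp_all
  have h3 : ENNReal.ofReal |((Matrix.of v)ᵀ).det| * volume S ≤ 1 * volume S := by
    rw [one_mul]; exact h2
  have h4 := (ENNReal.mul_le_mul_iff_left hpos (stdS_vol_lt_top d)).1 h3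
  exact ENNReal.ofReal_le_one.1 h4

theorem int_coeffs {d : ℕ} (v : Fin d → Fin d → ℝ) (hint : ∀ i, IsIntVec (v i))
    (hli : LinearIndependent ℝ v) (hdet : |((Matrix.of v)ᵀ).det| ≤ 1)
    (z : Fin d → ℝ) (hz : IsIntVec z) (a : Fin d → ℝ) (ha : z = ∑ i, a i • v i) :
    ∀ i, ∃ m : ℤ, a i = m := by
  choose B hB using hint
  choose y hy using hz
  have hA : (Matrix.of v)ᵀ = ((Matrix.of B)ᵀ).map (Int.castRingHom ℝ) := by
    ext i j; simp [hB]
  have hne : ((Matrix.of v)ᵀ).det ≠ 0 := by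
    rw [Matrix.det_transpose]
    have : LinearIndependent ℝ (Matrix.of v).row := hli
    rw [Matrix.linearIndependent_rows_iff_isUnit, Matrix.isUnit_iff_isUnit_det] at this
    exact this.ne_zero
  have hdc : ((Matrix.of v)ᵀ).det = ((((Matrix.of B)ᵀ).det : ℤ) : ℝ) := by
    rw [hA]; simpa using (RingHom.map_det (Int.castRingHom ℝ) ((Matrix.of B)ᵀ)).symm
  have hmul : (Matrix.of v)ᵀ *ᵥ a = z := by
    rw [ha]; ext j; simp [Matrix.mulVec, dotProduct, mul_comm]
  have hadj : ((Matrix.of v)ᵀ).adjugate *ᵥ z = ((Matrix.of v)ᵀ).det • a := by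
    rw [← hmul, Matrix.mulVec_mulVec, Matrix.adjugate_mul, Matrix.smul_mulVec, Matrix.one_mulVec]
  intro i
  have hi := congrFun hadj i
  have hadjc : ((Matrix.of v)ᵀ).adjugate = (((Matrix.of B)ᵀ).adjugate).map (Int.castRingHom ℝ) := by
    rw [hA]; exact (RingHom.map_adjugate (Int.castRingHom ℝ) ((Matrix.of B)ᵀ)).symm
  have hl : (((Matrix.of v)ᵀ).adjugate *ᵥ z) i =
      (((((Matrix.of B)ᵀ).adjugate *ᵥ y) i : ℤ) : ℝ) := by
    rw [hadjc]; simp [Matrix.mulVec, dotProduct, hy]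
  rw [hl, hdc, Pi.smul_apply, smul_eq_mul] at hi
  rw [hdc] at hdet hne
  have hne' : ((Matrix.of B)ᵀ).det ≠ 0 := by exact_mod_cast hne
  have hdet' : |((Matrix.of B)ᵀ).det| ≤ 1 := by exact_mod_cast hdet
  have : ((Matrix.of B)ᵀ).det = 1 ∨ ((Matrix.of B)ᵀ).det = -1 := by
    rw [abs_le] at hdet'; omega
  rcases this with h | h
  · exact ⟨_, by rw [hi, h]; simp⟩
  · refine ⟨-(((Matrix.of B)ᵀ).adjugate *ᵥ y) i, ?_⟩
    rw [Int.cast_neg, hi, h]; simp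

theorem exists_nat_coeffs {d : ℕ} (V : Finset (Fin d → ℝ)) (hs : IsSimplex d V)
    (h0 : (0 : Fin d → ℝ) ∈ V) (hint : ∀ v ∈ V, IsIntVec v)
    (hvol : MeasureTheory.volume (convexHull ℝ (V : Set (Fin d → ℝ)))
      = ENNReal.ofReal (1 / (Nat.factorial d)))
    (z : Fin d → ℝ) (hz : IsIntVec z) (t : ℝ) (ht : 0 < t)
    (hmem : t • z ∈ convexHull ℝ (V : Set (Fin d → ℝ))) :
    ∃ (v : Fin d → Fin d → ℝ) (a : Fin d → ℕ), (∀ i, v i ∈ V) ∧ (∀ i, v i ≠ 0) ∧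
      z = ∑ i, (a i : ℝ) • v i := by
  have hcard : Fintype.card (V.erase 0) = d := by
    rw [Fintype.card_coe, Finset.card_erase_of_mem h0, hs.1]; simp
  let e : Fin d ≃ V.erase 0 := (Fintype.equivFinOfCardEq hcard).symm
  let v : Fin d → Fin d → ℝ := fun i => (e i : Fin d → ℝ)
  have hvV : ∀ i, v i ∈ V := fun i => Finset.mem_of_mem_erase (e i).2
  have hv0 : ∀ i, v i ≠ 0 := fun i => Finset.ne_of_mem_erase (e i).2
  have hli : LinearIndependent ℝ v := by
    have h := (affineIndependent_iff_linearIndependent_vsub ℝ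
      (fun v : V => (v : Fin d → ℝ)) ⟨0, h0⟩).1 hs.2
    have h2 := h.comp (fun i : Fin d => (⟨⟨v i, hvV i⟩, fun h => hv0 i (congrArg Subtype.val h)⟩ :
      {x : V // x ≠ ⟨0, h0⟩})) (by
        intro i j hij
        have : v i = v j := congrArg (fun x => (x.1.1 : Fin d → ℝ)) hij
        exact e.injective (Subtype.ext this))
    simpa [Function.comp_def] using h2
  rw [Finset.mem_convexHull'] at hmem
  obtain ⟨w, hw0, -, hw⟩ := hmem
  have hsum : t • z = ∑ i, w (v i) • v i := by
    rw [← hw, ← Finset.add_sum_erase _ _ h0, smul_zero, zero_add, ← Finset.sum_coe_sort]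
    exact (Equiv.sum_comp e (fun x : V.erase 0 => w x • (x : Fin d → ℝ))).symm
  have hz2 : z = ∑ i, (t⁻¹ * w (v i)) • v i := by
    simp only [mul_smul, ← Finset.smul_sum]
    rw [← hsum, smul_smul, inv_mul_cancel₀ ht.ne', one_smul]
  have hc := int_coeffs v (fun i => hint _ (hvV i)) hli (det_le_one V h0 v hvV hvol) z hz _ hz2
  have hn : ∀ i, ∃ n : ℕ, t⁻¹ * w (v i) = n := by
    intro i
    obtain ⟨m, hm⟩ := hc i
    have : (0:ℝ) ≤ m := by rw [← hm]; exact mul_nonneg (inv_nonneg.2 ht.le) (hw0 _ (hvV i))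
    have : 0 ≤ m := by exact_mod_cast this
    lift m to ℕ using this
    exact ⟨m, by simpa using hm⟩
  choose a ha using hn
  exact ⟨v, a, hvV, hv0, by rw [hz2]; simp [ha]⟩

theorem sphere_compact (d : ℕ) : IsCompact {u : Fin d → ℝ | euclNorm u = 1} := by
  have hcont : Continuous (fun u : Fin d → ℝ => euclNorm u) := by
    unfold euclNorm dotProduct; fun_prop
  refine IsCompact.of_isClosed_subset (isCompact_Icc (a := (-1 : Fin d → ℝ)) (b := 1))
    (isClosed_eq hcont continuous_const) ?_
  intro u hu
  have h : u ⬝ᵥ u = 1 := by simpa [euclNorm] using hu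
  have hi : ∀ i, u i * u i ≤ 1 := fun i => by
    rw [← h]; exact Finset.single_le_sum (f := fun i => u i * u i) (fun j _ => mul_self_nonneg _) (Finset.mem_univ i)
  exact ⟨fun i => by have := hi i; simp; nlinarith, fun i => by have := hi i; simp; nlinarith⟩

theorem normM_cont {d : ℕ} (M : Matrix (Fin d) (Fin d) ℝ) : Continuous (normM M) := by
  unfold normM dotProduct Matrix.mulVec dotProduct; fun_prop

theorem quad_pos {d : ℕ} {M : Matrix (Fin d) (Fin d) ℝ} (hM : M.PosDef) {u : Fin d → ℝ}
    (hu : u ≠ 0) : 0 < u ⬝ᵥ M.mulVec u := by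
  simpa using hM.dotProduct_mulVec_pos hu

theorem normM_pos {d : ℕ} {M : Matrix (Fin d) (Fin d) ℝ} (hM : M.PosDef) {u : Fin d → ℝ}
    (hu : u ≠ 0) : 0 < normM M u := Real.sqrt_pos.2 (quad_pos hM hu)

theorem normM_sq {d : ℕ} {M : Matrix (Fin d) (Fin d) ℝ} (hM : M.PosDef) (u : Fin d → ℝ) :
    normM M u ^ 2 = u ⬝ᵥ M.mulVec u := by
  rw [normM, Real.sq_sqrt]
  by_cases hu : u = 0
  · simp [hu]
  · exact (quad_pos hM hu).le

theorem normM_smul {d : ℕ} (M : Matrix (Fin d) (Fin d) ℝ) (c : ℝ) (hc : 0 ≤ c)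
    (u : Fin d → ℝ) : normM M (c • u) = c * normM M u := by
  rw [normM, normM, Matrix.mulVec_smul, smul_dotProduct, dotProduct_smul, smul_eq_mul,
    smul_eq_mul, ← mul_assoc, Real.sqrt_mul (by positivity), Real.sqrt_mul_self hc]

theorem normM_neg {d : ℕ} (M : Matrix (Fin d) (Fin d) ℝ) 
    (u : Fin d → ℝ) : normM M (-u) = normM M u := by
  simp [normM, Matrix.mulVec_neg]

theorem unit_ne_zero {d : ℕ} {u : Fin d → ℝ} (hu : euclNorm u = 1) : u ≠ 0 := by
  rintro rfl; simp [euclNorm] at hu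

theorem euclNorm_pos {d : ℕ} {u : Fin d → ℝ} (hu : u ≠ 0) : 0 < euclNorm u := by
  apply Real.sqrt_pos.2
  have := dotProduct_star_self_pos_iff.2 hu
  simpa using this

theorem euclNorm_normalize {d : ℕ} {u : Fin d → ℝ} (hu : u ≠ 0) :
    euclNorm ((euclNorm u)⁻¹ • u) = 1 := by
  have h := euclNorm_pos hu
  have h2 : euclNorm u * euclNorm u = u ⬝ᵥ u := Real.mul_self_sqrt (Real.sqrt_pos.1 h).le
  rw [euclNorm, Real.sqrt_eq_one, smul_dotProduct, dotProduct_smul, ← h2]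
  simp only [smul_eq_mul]; field_simp

theorem kappa_ge {d : ℕ} {M : Matrix (Fin d) (Fin d) ℝ} (hM : M.PosDef) (u v : Fin d → ℝ)
    (hu : euclNorm u = 1) (hv : euclNorm v = 1) : normM M u / normM M v ≤ kappa M := by
  unfold kappa
  refine le_csSup ?_ ⟨u, v, hu, hv, rfl⟩
  have := ((sphere_compact d).prod (sphere_compact d)).bddAbove_image
    (f := fun p : (Fin d → ℝ) × (Fin d → ℝ) => normM M p.1 / normM M p.2) (by
      apply ContinuousOn.div
      · exact ((normM_cont M).comp continuous_fst).continuousOn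
      · exact ((normM_cont M).comp continuous_snd).continuousOn
      · rintro p ⟨_, h⟩
        exact (normM_pos hM (unit_ne_zero h)).ne')
  refine this.mono ?_
  rintro _ ⟨a, b, ha, hb, rfl⟩
  exact ⟨(a, b), ⟨ha, hb⟩, rfl⟩

theorem dTimes_ge {d : ℕ} {M N : Matrix (Fin d) (Fin d) ℝ} (hM : M.PosDef) (hN : N.PosDef)
    (u : Fin d → ℝ) (hu : u ≠ 0) :
    |Real.log (normM M u) - Real.log (normM N u)| ≤ dTimes M N := by
  unfold dTimes
  refine le_csSup ?_ ⟨u, hu, rfl⟩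
  have := (sphere_compact d).bddAbove_image
    (f := fun u => |Real.log (normM M u) - Real.log (normM N u)|) (by
      apply ContinuousOn.abs
      apply ContinuousOn.sub
      · exact (normM_cont M).continuousOn.log fun x hx => (normM_pos hM (unit_ne_zero hx)).ne'
      · exact (normM_cont N).continuousOn.log fun x hx => (normM_pos hN (unit_ne_zero hx)).ne')
  refine this.mono ?_
  rintro _ ⟨a, ha, rfl⟩
  refine ⟨(euclNorm a)⁻¹ • a, euclNorm_normalize ha, ?_⟩
  have h := inv_pos.2 (euclNorm_pos ha)
  simp only
  rw [normM_smul _ _ h.le, normM_smul _ _ h.le, Real.log_mul h.ne' (normM_pos hM ha).ne',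
    Real.log_mul h.ne' (normM_pos hN ha).ne']
  congr 1; ring

theorem sq_le_of_dTimes {d : ℕ} {M N : Matrix (Fin d) (Fin d) ℝ} (hM : M.PosDef) (hN : N.PosDef)
    (u : Fin d → ℝ) (hu : u ≠ 0) :
    normM M u ^ 2 ≤ Real.exp (2 * dTimes M N) * normM N u ^ 2 ∧
    normM N u ^ 2 ≤ Real.exp (2 * dTimes M N) * normM M u ^ 2 := by
  have h := abs_le.1 (dTimes_ge hM hN u hu)
  have a := normM_pos hM hu
  have b := normM_pos hN hu
  have e : Real.exp (2 * dTimes M N) = Real.exp (dTimes M N) ^ 2 := by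
    rw [← Real.exp_nat_mul]; norm_num
  rw [e, ← mul_pow, ← mul_pow]
  constructor
  · apply pow_le_pow_left₀ a.le
    rw [← Real.log_le_log_iff a (by positivity), Real.log_mul (Real.exp_pos _).ne' b.ne', Real.log_exp]
    linarith
  · apply pow_le_pow_left₀ b.le
    rw [← Real.log_le_log_iff b (by positivity), Real.log_mul (Real.exp_pos _).ne' a.ne', Real.log_exp]
    linarith

theorem span_sum {d : ℕ} {u : Fin d → Fin d → ℝ} {k : ℕ} (v : Fin d → Fin d → ℝ) (a : Fin d → ℤ)
    (h : ∀ i, a i ≠ 0 → InLatticeSpan u k (v i)) :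
    InLatticeSpan u k (∑ i, (a i : ℝ) • v i) := by
  apply Finset.sum_induction _ (InLatticeSpan u k)
  · rintro x y ⟨c, hc, rfl⟩ ⟨c', hc', rfl⟩
    exact ⟨c + c', fun i hi => by simp [hc i hi, hc' i hi],
      by simp [add_smul, Finset.sum_add_distrib]⟩
  · exact ⟨0, by simp, by simp⟩
  · intro i _
    by_cases h0 : a i = 0
    · exact ⟨0, by simp, by simp [h0]⟩
    · obtain ⟨c, hc, e⟩ := h i h0
      exact ⟨fun j => a i * c j, fun j hj => by simp [hc j hj],
        by rw [e]; simp [Finset.smul_sum, mul_smul]⟩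

theorem basis_not_span {d : ℕ} {u : Fin d → Fin d → ℝ} (hdet : |(Matrix.of u).det| = 1)
    (k : Fin d) : ¬ InLatticeSpan u (k : ℕ) (u k) := by
  rintro ⟨c, hc, e⟩
  have hli : LinearIndependent ℝ (Matrix.of u).row := by
    rw [Matrix.linearIndependent_rows_iff_isUnit, Matrix.isUnit_iff_isUnit_det, isUnit_iff_ne_zero]
    intro h; rw [h] at hdet; simp at hdet
  have hli : LinearIndependent ℝ u := hli
  rw [Fintype.linearIndependent_iff] at hli
  have := hli (fun i => (c i : ℝ) - if i = k then 1 else 0) (by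
    simp only [sub_smul, Finset.sum_sub_distrib, ← e]; simp) k
  simp [hc k (lt_irrefl _)] at this

theorem main_vertex {d : ℕ} 
    (M N : Matrix (Fin d) (Fin d) ℝ) (hM : M.PosDef) (hN : N.PosDef)
    (hdist : dTimes M N < Real.log (1 + ((kappa M) ^ 2)⁻¹) / 4)
    (u : Fin d → Fin d → ℝ) (k : ℕ) (z : Fin d → ℝ) (hz : IsIntVec z)
    (hzs : ¬ InLatticeSpan u k z)
    (hmin : ∀ y : Fin d → ℝ, IsIntVec y → ¬ InLatticeSpan u k y → normM M z ≤ normM M y)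
    (𝒯 : Finset (Finset (Fin d → ℝ))) (h𝒯 : IsReducedMesh N 𝒯) : IsMeshVertex 𝒯 z := by
  obtain ⟨hmesh, hnb, hint, hvol, h0, hac⟩ := h𝒯
  have hz0 : z ≠ 0 := by
    rintro rfl; exact hzs ⟨0, by simp, by simp⟩
  -- a small multiple lies in some simplex
  have htend : Filter.Tendsto (fun t : ℝ => t • z) (nhdsWithin 0 (Set.Ioi 0)) (nhds 0) := by
    have : Continuous (fun t : ℝ => t • z) := by fun_prop
    have := this.tendsto 0
    rw [zero_smul] at this
    exact this.mono_left nhdsWithin_le_nhds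
  obtain ⟨t, htm, htpos⟩ := ((htend.eventually hnb).and self_mem_nhdsWithin).exists
  have htpos : 0 < t := htpos
  obtain ⟨V, hV, htm⟩ := Set.mem_iUnion₂.1 htm
  obtain ⟨v, a, hvV, hv0, hza⟩ := exists_nat_coeffs V (hmesh.1 V hV) (h0 V hV) (hint V hV)
    (hvol V hV) z hz t htpos htm
  -- some vertex outside the span
  have hex : ∃ i, a i ≠ 0 ∧ ¬ InLatticeSpan u k (v i) := by
    by_contra hcon
    push Not at hcon
    apply hzs
    have := span_sum (u := u) (k := k) v (fun i => (a i : ℤ)) (fun i hi => hcon i (by simpa using hi))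
    rw [hza]; simpa using this
  obtain ⟨i, hai, his⟩ := hex
  let b : Fin d → ℕ := fun j => a j - if j = i then 1 else 0
  have hab : ∀ j, (a j : ℝ) = (if j = i then 1 else 0) + b j := by
    intro j
    simp only [b]
    split_ifs with h
    · subst h
      rw [Nat.cast_sub (Nat.one_le_iff_ne_zero.2 hai)]; simp
    · simp
  set w : Fin d → ℝ := ∑ j, (b j : ℝ) • v j with hw
  have hzw : z = v i + w := by
    rw [hza]; simp [hab, add_smul, Finset.sum_add_distrib, hw]
  by_cases hw0 : w = 0
  · exact ⟨V, hV, by rw [hzw, hw0, add_zero]; exact hvV i⟩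
  exfalso
  have hwint : IsIntVec w := by
    intro l
    choose m hm using fun j => hint V hV (v j) (hvV j) l
    exact ⟨∑ j, (b j : ℤ) * m j, by simp [hw, hm]⟩
  have hc1 : 0 ≤ v i ⬝ᵥ N.mulVec w := by
    rw [hw, Matrix.mulVec_sum, dotProduct_sum]
    refine Finset.sum_nonneg fun j _ => ?_
    rw [Matrix.mulVec_smul, dotProduct_smul]
    exact mul_nonneg (Nat.cast_nonneg _) (hac V hV _ (hvV i) _ (hvV j) (hv0 i) (hv0 j))
  have hc2 : 0 ≤ w ⬝ᵥ N.mulVec (v i) := by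
    rw [hw, sum_dotProduct]
    refine Finset.sum_nonneg fun j _ => ?_
    rw [smul_dotProduct]
    exact mul_nonneg (Nat.cast_nonneg _) (hac V hV _ (hvV j) _ (hvV i) (hv0 j) (hv0 i))
  have hpyth : normM N (v i) ^ 2 + normM N w ^ 2 ≤ normM N z ^ 2 := by
    rw [normM_sq hN, normM_sq hN, normM_sq hN, hzw, Matrix.mulVec_add, add_dotProduct,
      dotProduct_add, dotProduct_add]
    linarith
  have hvi := hmin (v i) (hint V hV _ (hvV i)) his
  -- canonical basis vector outside the span
  have hej : ∃ j : Fin d, ¬ InLatticeSpan u k (Pi.single j 1) := by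
    by_contra hcon
    push Not at hcon
    apply hzs
    choose m hm using hz
    have := span_sum (u := u) (k := k) (fun j => Pi.single j 1) m (fun i _ => hcon i)
    convert this using 1
    ext l
    simp [hm, Finset.sum_apply, Pi.single_apply]
  obtain ⟨j, hj⟩ := hej
  have hej1 : euclNorm (Pi.single j 1 : Fin d → ℝ) = 1 := by simp [euclNorm]
  have hze := hmin (Pi.single j 1) (fun l => by
    by_cases h : l = j
    · exact ⟨1, by subst h; simp⟩
    · exact ⟨0, by simp [h]⟩) hj
  have hwn : 1 ≤ euclNorm w := by
    rw [euclNorm, Real.one_le_sqrt]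
    have hp := Real.sqrt_pos.1 (euclNorm_pos hw0)
    choose m hm using hwint
    have e : w ⬝ᵥ w = ((∑ l, m l * m l : ℤ) : ℝ) := by simp [dotProduct, hm]
    rw [e] at hp ⊢
    exact_mod_cast hp
  have hk := kappa_ge hM _ _ hej1 (euclNorm_normalize hw0)
  have hk1 : 0 < kappa M := by
    refine lt_of_lt_of_le one_pos ?_
    have := kappa_ge hM _ _ hej1 hej1
    rwa [div_self (normM_pos hM (unit_ne_zero hej1)).ne'] at this
  have hwp := normM_pos hM hw0
  rw [normM_smul _ _ (inv_nonneg.2 (by linarith)), div_le_iff₀ (by positivity)] at hk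
  have hk2 : normM M z ≤ kappa M * normM M w := by
    refine hze.trans (hk.trans ?_)
    apply mul_le_mul_of_nonneg_left _ hk1.le
    have : (euclNorm w)⁻¹ ≤ 1 := inv_le_one_of_one_le₀ hwn
    nlinarith
  have hzp := normM_pos hM hz0
  have hk3 : ((kappa M)^2)⁻¹ * normM M z ^ 2 ≤ normM M w ^ 2 := by
    rw [inv_mul_le_iff₀ (by positivity), ← mul_pow]
    exact pow_le_pow_left₀ hzp.le hk2 2
  obtain ⟨-, g1⟩ := sq_le_of_dTimes hM hN z hz0
  obtain ⟨g2, -⟩ := sq_le_of_dTimes hM hN w hw0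
  obtain ⟨g3, -⟩ := sq_le_of_dTimes hM hN (v i) (hv0 i)
  set E := Real.exp (2 * dTimes M N) with hE
  have hEp : 0 < E := Real.exp_pos _
  have hEE : E * E < 1 + ((kappa M)^2)⁻¹ := by
    rw [hE, ← Real.exp_add, ← Real.lt_log_iff_exp_lt (by positivity)]
    linarith
  have hvi2 : normM M z ^ 2 ≤ normM M (v i) ^ 2 := pow_le_pow_left₀ hzp.le hvi 2
  have f1 : (1 + ((kappa M)^2)⁻¹) * normM M z ^ 2 ≤ E * normM N z ^ 2 := by
    nlinarith [mul_le_mul_of_nonneg_left hpyth hEp.le]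
  have f2 : E * normM N z ^ 2 ≤ (E * E) * normM M z ^ 2 := by
    nlinarith [mul_le_mul_of_nonneg_left g1 hEp.le]
  have f3 := mul_lt_mul_of_pos_right hEE (pow_pos hzp 2)
  linarith

/-- Corollary `corolBasisVertex`: if `d_×(M,N) < ln(1+κ(M)⁻²)/4` then the vectors of any
`M`-reduced basis, and their opposites, are vertices of any `N`-reduced mesh. -/
theorem stmt5 {d : ℕ} (hd1 : 1 ≤ d) (hd4 : d ≤ 4)
    (M N : Matrix (Fin d) (Fin d) ℝ) (hM : M.PosDef) (hN : N.PosDef)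
    (hdist : dTimes M N < Real.log (1 + ((kappa M) ^ 2)⁻¹) / 4)
    (u : Fin d → Fin d → ℝ) (hu : IsReducedBasis M u)
    (𝒯 : Finset (Finset (Fin d → ℝ))) (h𝒯 : IsReducedMesh N 𝒯) :
    ∀ i : Fin d, IsMeshVertex 𝒯 (u i) ∧ IsMeshVertex 𝒯 (-(u i)) := by
  intro i
  obtain ⟨hint, hdet, hmin⟩ := hu
  have hns := basis_not_span hdet i
  refine ⟨main_vertex M N hM hN hdist u i (u i) (hint i) hns (hmin i) 𝒯 h𝒯,
    main_vertex M N hM hN hdist u i (-(u i)) ?_ ?_ ?_ 𝒯 h𝒯⟩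
  · intro l
    obtain ⟨m, hm⟩ := hint i l
    exact ⟨-m, by simp [hm]⟩
  · rintro ⟨c, hc, e⟩
    exact hns ⟨-c, fun j hj => by simp [hc j hj], by rw [← neg_neg (u i), e]; simp⟩
  · intro y hy hys
    rw [normM_neg]
    exact hmin i y hy hys

end
end

section
/- Let M ∈ S_3^+ and let (u_1,u_2,u_3) be an M-reduced basis of ℤ³. Suppose ε_1, ε_2, ε_3 ∈ {−1,1} are such that u := ε_1 u_1, v := ε_2 u_2, w := ε_3 u_3 satisfy uᵀ M v ≥ 0, uᵀ M w ≥ 0 and vᵀ M w ≤ 0 (this is possible when the number of non-negative scalar products among u_1ᵀMu_2, u_2ᵀMu_3, u_3ᵀMu_1 is odd). Then the collection 𝒯 of the 24 tetrahedra having 0 as a vertex together with one of the triplets {w,u,w+v}, {w,w+v,w+v−u}, {w,w+v−u,w−u}, {w,w−u,−v}, {w,−v,u−v}, {w,u−v,u}, {v,w+v,u}, {v,w+v−u,w+v}, {v,v−u,w+v−u}, {−u,−v,w−u}, {−u,w−u,w+v−u}, {−u,w+v−u,v−u}, or one of their opposites (the opposite of {a,b,c} being {−a,−b,−c}), is an M-reduced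 mesh. -/
open Matrix
open scoped BigOperators ENNReal Classical

noncomputable section

section VolumePart
open MeasureTheory

def cornerS (n : ℕ) (r : ℝ) : Set (Fin n → ℝ) := {x | (∀ i, 0 ≤ x i) ∧ ∑ i, x i ≤ r}

theorem measurableSet_cornerS (n : ℕ) (r : ℝ) : MeasurableSet (cornerS n r) := by
  apply IsClosed.measurableSet
  have : cornerS n r = (⋂ i, {x | 0 ≤ x i}) ∩ {x | ∑ i, x i ≤ r} := by
    ext x; simp [cornerS]
  rw [this]
  refine IsClosed.inter (isClosed_iInter fun i => ?_) ?_
  · exact isClosed_le continuous_const (continuous_apply i)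
  · exact isClosed_le (by fun_prop) continuous_const

theorem volume_cornerS (n : ℕ) : ∀ r : ℝ, 0 ≤ r →
    volume (cornerS n r) = ENNReal.ofReal (r ^ n / n.factorial) := by
  induction n with
  | zero =>
    intro r hr
    have : cornerS 0 r = Set.univ := by ext x; simp [cornerS, hr]
    rw [this]
    simp [volume_pi]
  | succ n ih =>
    intro r hr
    have mp := (volume_preserving_piFinSuccAbove (fun _ : Fin (n+1) => ℝ) 0).symm
    rw [← mp.measure_preimage (measurableSet_cornerS _ _).nullMeasurableSet]
    rw [Measure.volume_eq_prod, Measure.prod_apply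
      (mp.measurable (measurableSet_cornerS _ _))]
    have key : ∀ x : ℝ, volume (Prod.mk x ⁻¹' ((MeasurableEquiv.piFinSuccAbove
        (fun _ : Fin (n+1) => ℝ) 0).symm ⁻¹' cornerS (n+1) r)) =
        (Set.Icc 0 r).indicator (fun x => ENNReal.ofReal ((r - x) ^ n / n.factorial)) x := by
      intro x
      by_cases hx : x ∈ Set.Icc 0 r
      · rw [Set.indicator_of_mem hx, ← ih (r - x) (by linarith [hx.2])]
        congr 1
        ext y
        simp [cornerS, MeasurableEquiv.piFinSuccAbove, Fin.forall_fin_succ, Fin.sum_univ_succ, hx.1, le_sub_iff_add_le, add_comm]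
      · rw [Set.indicator_of_notMem hx]
        convert measure_empty (μ := volume)
        ext y
        simp [cornerS, MeasurableEquiv.piFinSuccAbove, Fin.forall_fin_succ, Fin.sum_univ_succ]
        intro h0 h1
        have := Finset.sum_nonneg (fun i (_ : i ∈ Finset.univ) => h1 i)
        by_contra hc
        exact hx ⟨h0, by linarith⟩
    simp_rw [key]
    rw [lintegral_indicator measurableSet_Icc, ← ofReal_integral_eq_lintegral_ofReal]
    · congr 1
      rw [integral_Icc_eq_integral_Ioc, ← intervalIntegral.integral_of_le hr]
      rw [intervalIntegral.integral_comp_sub_left (fun x => x ^ n / (n.factorial : ℝ))]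
      simp [Nat.factorial_succ]
      field_simp
    · exact (Continuous.continuousOn (by fun_prop)).integrableOn_Icc
    · refine (ae_restrict_iff' measurableSet_Icc).2 (Filter.Eventually.of_forall fun x hx => ?_)
      have : 0 ≤ r - x := by linarith [hx.2]
      simp only [Pi.zero_apply]
      positivity

end VolumePart

/-- The vertices of the tetrahedron with apex the origin. -/
def tetra (t : Fin 3 → Fin 3 → ℝ) : Finset (Fin 3 → ℝ) := {0, t 0, t 1, t 2}

theorem mem_tetra {t : Fin 3 → Fin 3 → ℝ} {x : Fin 3 → ℝ} :
    x ∈ tetra t ↔ x = 0 ∨ ∃ i, x = t i := by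
  simp [tetra, Fin.exists_fin_succ]

/-- Nonnegative combinations of mass at most one lie in any convex set containing zero. -/
theorem comb_mem_convex {K : Set (Fin 3 → ℝ)} (hK : Convex ℝ K) (h0 : (0 : Fin 3 → ℝ) ∈ K)
    (t : Fin 3 → Fin 3 → ℝ) (a : Fin 3 → ℝ) (ha : a ∈ cornerS 3 1)
    (ht : ∀ i, a i ≠ 0 → t i ∈ K) : ∑ i, a i • t i ∈ K := by
  have h1 : ∑ i, a i • t i = (1 - ∑ i, a i) • (0 : Fin 3 → ℝ)
      + ∑ i, a i • (if a i = 0 then 0 else t i) := by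
    rw [smul_zero, zero_add]
    refine Finset.sum_congr rfl fun i _ => ?_
    split_ifs with h <;> simp [h]
  have h2 := hK.sum_mem (t := Finset.univ)
    (w := (Fin.cons (1 - ∑ i, a i) a : Fin 4 → ℝ))
    (z := (Fin.cons 0 (fun i => if a i = 0 then 0 else t i) : Fin 4 → Fin 3 → ℝ))
    (by
      intro i _
      refine Fin.cases ?_ (fun j => ?_) i
      · simpa using ha.2
      · simpa using ha.1 j)
    (by rw [Fin.sum_univ_succ]; simp)
    (by
      intro i _
      refine Fin.cases ?_ (fun j => ?_) i
      · simpa using h0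
      · simp only [Fin.cons_succ]
        split_ifs with h
        · exact h0
        · exact ht j h)
  rw [Fin.sum_univ_succ] at h2
  rw [h1]
  simpa using h2

theorem convex_cornerS : Convex ℝ (cornerS 3 1) := by
  intro x hx y hy a b ha hb hab
  refine ⟨fun i => ?_, ?_⟩
  · have := hx.1 i
    have := hy.1 i
    simp only [Pi.add_apply, Pi.smul_apply, smul_eq_mul]
    positivity
  · have h1 := hx.2
    have h2 := hy.2
    simp only [Pi.add_apply, Pi.smul_apply, smul_eq_mul, Finset.sum_add_distrib,
      ← Finset.mul_sum]
    nlinarith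

theorem hull_tetra (t : Fin 3 → Fin 3 → ℝ) :
    convexHull ℝ (tetra t : Set (Fin 3 → ℝ)) =
      (Matrix.toLin' (Matrix.of t)ᵀ) '' cornerS 3 1 := by
  have happ : ∀ a : Fin 3 → ℝ, Matrix.toLin' (Matrix.of t)ᵀ a = ∑ i, a i • t i := by
    intro a
    ext j
    simp [Matrix.mulVec, dotProduct, mul_comm]
  apply Set.Subset.antisymm
  · apply convexHull_min
    · intro x hx
      rcases mem_tetra.1 hx with rfl | ⟨i, rfl⟩
      · exact ⟨0, by simp [cornerS], by simp⟩
      · refine ⟨Pi.single i 1, ⟨fun j => ?_, by simp⟩, ?_⟩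
        · by_cases h : j = i
          · subst h; simp
          · simp [h]
        · rw [happ]
          simp [Pi.single_apply]
    · exact convex_cornerS.linear_image _
  · rintro _ ⟨a, ha, rfl⟩
    rw [happ]
    refine comb_mem_convex (convex_convexHull ℝ _) ?_ t a ha ?_
    · exact subset_convexHull ℝ _ (mem_tetra.2 (Or.inl rfl))
    · intro i _
      exact subset_convexHull ℝ _ (mem_tetra.2 (Or.inr ⟨i, rfl⟩))

theorem mem_hull_tetra {t : Fin 3 → Fin 3 → ℝ} {x : Fin 3 → ℝ} :
    x ∈ convexHull ℝ (tetra t : Set (Fin 3 → ℝ)) ↔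
      ∃ a ∈ cornerS 3 1, x = ∑ i, a i • t i := by
  rw [hull_tetra]
  constructor
  · rintro ⟨a, ha, rfl⟩
    refine ⟨a, ha, ?_⟩
    ext j
    simp [Matrix.mulVec, dotProduct, mul_comm]
  · rintro ⟨a, ha, rfl⟩
    refine ⟨a, ha, ?_⟩
    ext j
    simp [Matrix.mulVec, dotProduct, mul_comm]

theorem volume_tetra (t : Fin 3 → Fin 3 → ℝ) (ht : |(Matrix.of t).det| = 1) :
    MeasureTheory.volume (convexHull ℝ (tetra t : Set (Fin 3 → ℝ)))
      = ENNReal.ofReal (1 / (Nat.factorial 3)) := by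
  rw [hull_tetra, MeasureTheory.Measure.addHaar_image_linearMap, LinearMap.det_toLin',
    Matrix.det_transpose, ht, volume_cornerS 3 1 zero_le_one]
  simp

theorem linInd_of_det (t : Fin 3 → Fin 3 → ℝ) (ht : |(Matrix.of t).det| = 1) :
    LinearIndependent ℝ t := by
  have h : (Matrix.of t).det ≠ 0 := by
    intro h; rw [h] at ht; simp at ht
  exact Matrix.linearIndependent_rows_of_det_ne_zero h

theorem isSimplex_tetra (t : Fin 3 → Fin 3 → ℝ) (ht : |(Matrix.of t).det| = 1) :
    IsSimplex 3 (tetra t) := by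
  have hl := linInd_of_det t ht
  have hne := hl.ne_zero
  have hinj := hl.injective
  constructor
  · have h01 : t 0 ≠ t 1 := fun h => by simpa using hinj h
    have h02 : t 0 ≠ t 2 := fun h => by simpa using hinj h
    have h12 : t 1 ≠ t 2 := fun h => by simpa using hinj h
    simp [tetra, Finset.card_insert_of_notMem, (hne 0).symm, (hne 1).symm, (hne 2).symm,
      h01, h02, h12]
  · have h0 : (0 : Fin 3 → ℝ) ∈ (tetra t : Set (Fin 3 → ℝ)) := mem_tetra.2 (Or.inl rfl)
    have := (affineIndependent_set_iff_linearIndependent_vsub ℝ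
      (s := (tetra t : Set (Fin 3 → ℝ))) h0).2
    apply this
    have hs : (fun p : Fin 3 → ℝ => p -ᵥ (0 : Fin 3 → ℝ)) ''
        ((tetra t : Set (Fin 3 → ℝ)) \ {0}) = Set.range t := by
      ext x
      simp only [vsub_eq_sub, sub_zero, Set.image_id', Set.mem_sdiff, Finset.mem_coe, mem_tetra,
        Set.mem_singleton_iff, Set.mem_range]
      constructor
      · rintro ⟨h | ⟨i, rfl⟩, h2⟩
        · exact absurd h h2
        · exact ⟨i, rfl⟩
      · rintro ⟨i, rfl⟩
        exact ⟨Or.inr ⟨i, rfl⟩, hne i⟩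
    rw [hs]
    exact hl.linearIndepOn_id

/-- Dual basis. -/
theorem exists_dual (t : Fin 3 → Fin 3 → ℝ) (ht : |(Matrix.of t).det| = 1) :
    ∃ A : Fin 3 → ((Fin 3 → ℝ) →ₗ[ℝ] ℝ), (∀ i j, A i (t j) = if i = j then 1 else 0) ∧
      ∀ x, x = ∑ i, A i x • t i := by
  let b := basisOfLinearIndependentOfCardEqFinrank (linInd_of_det t ht) (by simp)
  have hb : ∀ i, b i = t i := by intro i; simp [b]
  refine ⟨b.coord, ?_, ?_⟩
  · intro i j
    rw [← hb j]
    simp [Finsupp.single_apply, eq_comm]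
  · intro x
    conv_lhs => rw [← b.sum_repr x]
    simp [hb]

/-- Compatibility of the tetrahedra through a convex piecewise linear function. -/
theorem inter_hull (s t : Fin 3 → Fin 3 → ℝ) (f g : (Fin 3 → ℝ) →ₗ[ℝ] ℝ)
    (hs : ∀ i, g (s i) ≤ f (s i)) (ht : ∀ i, f (t i) ≤ g (t i))
    (hst : ∀ i, g (s i) = f (s i) → ∃ j, s i = t j) :
    (convexHull ℝ (tetra s : Set (Fin 3 → ℝ))) ∩ (convexHull ℝ (tetra t : Set (Fin 3 → ℝ)))
      = convexHull ℝ ((tetra s ∩ tetra t : Finset (Fin 3 → ℝ)) : Set (Fin 3 → ℝ)) := by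
  apply Set.Subset.antisymm
  · rintro x ⟨hx1, hx2⟩
    obtain ⟨a, ha, rfl⟩ := mem_hull_tetra.1 hx1
    obtain ⟨b, hb, hab⟩ := mem_hull_tetra.1 hx2
    have h1 : f (∑ i, a i • s i) ≤ g (∑ i, a i • s i) := by
      rw [hab, map_sum, map_sum]
      refine Finset.sum_le_sum fun i _ => ?_
      rw [map_smul, map_smul]
      exact mul_le_mul_of_nonneg_left (ht i) (hb.1 i)
    have h2 : ∑ i, a i * (f (s i) - g (s i)) ≤ 0 := by
      have e : ∑ i, a i * (f (s i) - g (s i)) = f (∑ i, a i • s i) - g (∑ i, a i • s i) := by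
        simp [map_sum, mul_sub, Finset.sum_sub_distrib]
      rw [e]; linarith
    have h3 : ∀ i ∈ Finset.univ, 0 ≤ a i * (f (s i) - g (s i)) := fun i _ =>
      mul_nonneg (ha.1 i) (by linarith [hs i])
    have h4 := (Finset.sum_eq_zero_iff_of_nonneg h3).1 (le_antisymm h2 (Finset.sum_nonneg h3))
    refine comb_mem_convex (convex_convexHull ℝ _) ?_ s a ha ?_
    · apply subset_convexHull
      simp [mem_tetra]
    · intro i hi
      apply subset_convexHull
      have h5 : f (s i) - g (s i) = 0 := by
        rcases mul_eq_zero.1 (h4 i (Finset.mem_univ i)) with h | h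
        · exact absurd h hi
        · exact h
      have h6 := hst i (by linarith)
      simp only [Finset.coe_inter, Set.mem_inter_iff, Finset.mem_coe, mem_tetra]
      exact ⟨Or.inr ⟨i, rfl⟩, Or.inr h6⟩
  · apply Set.subset_inter <;> apply convexHull_mono <;> simp

/-- Covering of a neighborhood of the origin. -/
theorem cover_nhds {n : ℕ} [NeZero n] (t : Fin n → Fin 3 → Fin 3 → ℝ)
    (f : Fin n → (Fin 3 → ℝ) →ₗ[ℝ] ℝ)
    (hdet : ∀ T, |(Matrix.of (t T)).det| = 1)
    (hle : ∀ S T i, f T (t S i) ≤ f S (t S i))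
    (heq : ∀ S T i, f T (t S i) = f S (t S i) → ∃ j, t S i = t T j)
    (hadj : ∀ T i, ∃ T', (∀ j, j ≠ i → ∃ k, t T j = t T' k) ∧ ∀ k, t T i ≠ t T' k) :
    (⋃ T, convexHull ℝ (tetra (t T) : Set (Fin 3 → ℝ))) ∈ nhds (0 : Fin 3 → ℝ) := by
  choose A hA hAx using fun T => exists_dual (t T) (hdet T)
  have hev : ∀ T, ∀ᶠ x in nhds (0 : Fin 3 → ℝ), ∑ i, A T i x < 1 := by
    intro T
    have hc : Continuous fun x => ∑ i, A T i x :=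
      continuous_finsetSum _ fun i _ => (A T i).continuous_of_finiteDimensional
    have := hc.tendsto 0
    simp only [map_zero, Finset.sum_const_zero] at this
    exact this.eventually (gt_mem_nhds zero_lt_one)
  filter_upwards [Filter.eventually_all.2 hev] with x hx
  obtain ⟨T, hT⟩ := Finite.exists_max (fun T => f T x)
  refine Set.mem_iUnion.2 ⟨T, mem_hull_tetra.2 ⟨fun i => A T i x, ⟨fun i => ?_, (hx T).le⟩,
    hAx T x⟩⟩
  obtain ⟨T', h1, h2⟩ := hadj T i
  have h3 : ∀ j, j ≠ i → f T (t T j) - f T' (t T j) = 0 := by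
    intro j hj
    obtain ⟨k, hk⟩ := h1 j hj
    have e1 := hle T T' j
    have e2 := hle T' T k
    rw [← hk] at e2
    linarith
  have h4 : 0 < f T (t T i) - f T' (t T i) := by
    rcases (hle T T' i).lt_or_eq with h | h
    · linarith
    · obtain ⟨k, hk⟩ := heq T T' i h
      exact absurd hk (h2 k)
  have h5 : f T x - f T' x = A T i x * (f T (t T i) - f T' (t T i)) := by
    have e : f T x - f T' x = ∑ j, A T j x * (f T (t T j) - f T' (t T j)) := by
      conv_lhs => rw [hAx T x]
      simp [map_sum, mul_sub, Finset.sum_sub_distrib]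
    rw [e, Finset.sum_eq_single i]
    · intro j _ hj
      rw [h3 j hj, mul_zero]
    · simp
  have h6 := hT T'
  by_contra hneg
  push Not at hneg
  have := mul_neg_of_neg_of_pos hneg h4
  linarith

/-- Coordinates of the vertices of the tetrahedra in the basis `(u, v, w)`. -/
def tri : Fin 24 → Fin 3 → ℤ × ℤ × ℤ := ![
  ![(0, 0, 1), (1, 0, 0), (0, 1, 1)],
  ![(0, 0, 1), (0, 1, 1), (-1, 1, 1)],
  ![(0, 0, 1), (-1, 1, 1), (-1, 0, 1)],
  ![(0, 0, 1), (-1, 0, 1), (0, -1, 0)],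
  ![(0, 0, 1), (0, -1, 0), (1, -1, 0)],
  ![(0, 0, 1), (1, -1, 0), (1, 0, 0)],
  ![(0, 1, 0), (0, 1, 1), (1, 0, 0)],
  ![(0, 1, 0), (-1, 1, 1), (0, 1, 1)],
  ![(0, 1, 0), (-1, 1, 0), (-1, 1, 1)],
  ![(-1, 0, 0), (0, -1, 0), (-1, 0, 1)],
  ![(-1, 0, 0), (-1, 0, 1), (-1, 1, 1)],
  ![(-1, 0, 0), (-1, 1, 1), (-1, 1, 0)],
  ![(0, 0, -1), (-1, 0, 0), (0, -1, -1)],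
  ![(0, 0, -1), (0, -1, -1), (1, -1, -1)],
  ![(0, 0, -1), (1, -1, -1), (1, 0, -1)],
  ![(0, 0, -1), (1, 0, -1), (0, 1, 0)],
  ![(0, 0, -1), (0, 1, 0), (-1, 1, 0)],
  ![(0, 0, -1), (-1, 1, 0), (-1, 0, 0)],
  ![(0, -1, 0), (0, -1, -1), (-1, 0, 0)],
  ![(0, -1, 0), (1, -1, -1), (0, -1, -1)],
  ![(0, -1, 0), (1, -1, 0), (1, -1, -1)],
  ![(1, 0, 0), (0, 1, 0), (1, 0, -1)],
  ![(1, 0, 0), (1, 0, -1), (1, -1, -1)],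
  ![(1, 0, 0), (1, -1, -1), (1, -1, 0)]]

/-- The linear pieces of a convex piecewise linear function adapted to the mesh. -/
def fn : Fin 24 → ℤ × ℤ × ℤ := ![
  (2, 0, 2), (0, 0, 2), (-1, -1, 2), (-1, -2, 2), (1, -2, 2), (2, -1, 2),
  (2, 2, 0), (0, 2, 0), (-1, 2, -1), (-2, -2, 1), (-2, -1, 1), (-2, 1, -1),
  (-2, 0, -2), (0, 0, -2), (1, 1, -2), (1, 2, -2), (-1, 2, -2), (-2, 1, -2),
  (-2, -2, 0), (0, -2, 0), (1, -2, 1), (2, 2, -1), (2, 1, -1), (2, -1, 1)]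

def dotZ (p q : ℤ × ℤ × ℤ) : ℤ := p.1 * q.1 + p.2.1 * q.2.1 + p.2.2 * q.2.2

def detZ (t : Fin 3 → ℤ × ℤ × ℤ) : ℤ :=
  (t 0).1 * ((t 1).2.1 * (t 2).2.2 - (t 1).2.2 * (t 2).2.1)
  - (t 0).2.1 * ((t 1).1 * (t 2).2.2 - (t 1).2.2 * (t 2).1)
  + (t 0).2.2 * ((t 1).1 * (t 2).2.1 - (t 1).2.1 * (t 2).1)

theorem tri_det : ∀ T, detZ (tri T) = 1 ∨ detZ (tri T) = -1 := by decide +kernel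

theorem tri_le : ∀ S T i, dotZ (fn T) (tri S i) ≤ dotZ (fn S) (tri S i) := by decide +kernel

theorem tri_eq : ∀ S T i, dotZ (fn T) (tri S i) = dotZ (fn S) (tri S i) →
    ∃ j, tri S i = tri T j := by decide +kernel

theorem tri_adj : ∀ T i, ∃ T', (∀ j, j ≠ i → ∃ k, tri T j = tri T' k) ∧
    ∀ k, tri T i ≠ tri T' k := by decide +kernel

/-- The point with coordinates `p` in the basis `(u, v, w)`. -/
def pt (u v w : Fin 3 → ℝ) (p : ℤ × ℤ × ℤ) : Fin 3 → ℝ :=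
  (p.1 : ℝ) • u + (p.2.1 : ℝ) • v + (p.2.2 : ℝ) • w

theorem isIntVec_pt {u v w : Fin 3 → ℝ} (hu : IsIntVec u) (hv : IsIntVec v) (hw : IsIntVec w)
    (p : ℤ × ℤ × ℤ) : IsIntVec (pt u v w p) := by
  intro i
  obtain ⟨a, ha⟩ := hu i
  obtain ⟨b, hb⟩ := hv i
  obtain ⟨c, hc⟩ := hw i
  refine ⟨p.1 * a + p.2.1 * b + p.2.2 * c, ?_⟩
  simp [pt, ha, hb, hc]

theorem det_pt (u v w : Fin 3 → ℝ) (t : Fin 3 → ℤ × ℤ × ℤ) :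
    (Matrix.of (fun i => pt u v w (t i))).det = detZ t * (Matrix.of ![u, v, w]).det := by
  simp [Matrix.det_fin_three, pt, detZ]
  ring

theorem gram_pt {M : Matrix (Fin 3) (Fin 3) ℝ} (hM : M.PosDef) (u v w : Fin 3 → ℝ)
    (p q : ℤ × ℤ × ℤ) :
    pt u v w p ⬝ᵥ M.mulVec (pt u v w q) =
      p.1 * q.1 * (u ⬝ᵥ M.mulVec u) + p.2.1 * q.2.1 * (v ⬝ᵥ M.mulVec v)
      + p.2.2 * q.2.2 * (w ⬝ᵥ M.mulVec w)
      + (p.1 * q.2.1 + p.2.1 * q.1) * (u ⬝ᵥ M.mulVec v)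
      + (p.1 * q.2.2 + p.2.2 * q.1) * (u ⬝ᵥ M.mulVec w)
      + (p.2.1 * q.2.2 + p.2.2 * q.2.1) * (v ⬝ᵥ M.mulVec w) := by
  have hs : Mᵀ = M := by simpa using hM.1.eq
  have hsym : ∀ x y : Fin 3 → ℝ, x ⬝ᵥ M.mulVec y = y ⬝ᵥ M.mulVec x := by
    intro x y
    rw [Matrix.dotProduct_mulVec, ← Matrix.mulVec_transpose, hs, dotProduct_comm]
  simp only [pt, Matrix.mulVec_add, Matrix.mulVec_smul, dotProduct_add, add_dotProduct,
    dotProduct_smul, smul_dotProduct, smul_eq_mul]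
  rw [hsym v u, hsym w u, hsym w v]
  ring

set_option maxHeartbeats 4000000 in
theorem acute_aux (uu vv ww uv uw vw : ℝ) (h1 : 0 ≤ uv) (h2 : 0 ≤ uw) (h3 : vw ≤ 0)
    (h0 : 0 ≤ uu) (h4 : uu ≤ vv) (h5 : vv ≤ ww) (h6 : 2 * uv ≤ uu) (h7 : 2 * uw ≤ uu)
    (h8 : -(2 * vw) ≤ vv) (h9 : 0 ≤ vv + uu + 2 * vw - 2 * uw - 2 * uv) (T : Fin 24)
    (i j : Fin 3) : 0 ≤
      ((tri T i).1 : ℝ) * (tri T j).1 * uu + (tri T i).2.1 * (tri T j).2.1 * vv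
      + (tri T i).2.2 * (tri T j).2.2 * ww
      + ((tri T i).1 * (tri T j).2.1 + (tri T i).2.1 * (tri T j).1) * uv
      + ((tri T i).1 * (tri T j).2.2 + (tri T i).2.2 * (tri T j).1) * uw
      + ((tri T i).2.1 * (tri T j).2.2 + (tri T i).2.2 * (tri T j).2.1) * vw := by
  fin_cases T <;> fin_cases i <;> fin_cases j <;> simp [tri] <;> linarith

theorem tri_mesh {M : Matrix (Fin 3) (Fin 3) ℝ} (u v w : Fin 3 → ℝ)
    (hu : IsIntVec u) (hv : IsIntVec v) (hw : IsIntVec w)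
    (hdet : |(Matrix.of ![u, v, w]).det| = 1)
    (hgram : ∀ T i j, 0 ≤ pt u v w (tri T i) ⬝ᵥ M.mulVec (pt u v w (tri T j)))
    (𝒯 : Finset (Finset (Fin 3 → ℝ)))
    (h𝒯 : ∀ V, V ∈ 𝒯 ↔ ∃ T, V = tetra (fun i => pt u v w (tri T i))) :
    IsReducedMesh M 𝒯 := by
  obtain ⟨A, hA, hAx⟩ := exists_dual _ hdet
  have hA0 : ∀ i, A i u = if i = 0 then 1 else 0 := fun i => by simpa using hA i 0
  have hA1 : ∀ i, A i v = if i = 1 then 1 else 0 := fun i => by simpa using hA i 1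
  have hA2 : ∀ i, A i w = if i = 2 then 1 else 0 := fun i => by simpa using hA i 2
  have hinj : ∀ p q, pt u v w p = pt u v w q → p = q := by
    intro p q h
    have e0 := congrArg (A 0) h
    have e1 := congrArg (A 1) h
    have e2 := congrArg (A 2) h
    simp [pt, hA0, hA1, hA2] at e0 e1 e2
    exact Prod.ext e0 (Prod.ext e1 e2)
  let f : Fin 24 → (Fin 3 → ℝ) →ₗ[ℝ] ℝ := fun T =>
    ((fn T).1 : ℝ) • A 0 + ((fn T).2.1 : ℝ) • A 1 + ((fn T).2.2 : ℝ) • A 2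
  have hf : ∀ T p, f T (pt u v w p) = (dotZ (fn T) p : ℝ) := by
    intro T p
    simp [f, pt, hA0, hA1, hA2, dotZ]
  have hd : ∀ T, |(Matrix.of (fun i => pt u v w (tri T i))).det| = 1 := by
    intro T
    rw [det_pt, abs_mul, hdet]
    rcases tri_det T with h | h <;> simp [h]
  have hle : ∀ S T i, f T (pt u v w (tri S i)) ≤ f S (pt u v w (tri S i)) := by
    intro S T i
    rw [hf, hf]
    exact_mod_cast tri_le S T i
  have heq : ∀ S T i, f T (pt u v w (tri S i)) = f S (pt u v w (tri S i)) →
      ∃ j, pt u v w (tri S i) = pt u v w (tri T j) := by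
    intro S T i h
    rw [hf, hf] at h
    obtain ⟨j, hj⟩ := tri_eq S T i (by exact_mod_cast h)
    exact ⟨j, by rw [hj]⟩
  refine ⟨⟨?_, ?_⟩, ?_, ?_, ?_, ?_, ?_⟩
  · intro V hV
    obtain ⟨T, rfl⟩ := (h𝒯 V).1 hV
    exact isSimplex_tetra _ (hd T)
  · intro V hV W hW
    obtain ⟨S, rfl⟩ := (h𝒯 V).1 hV
    obtain ⟨T, rfl⟩ := (h𝒯 W).1 hW
    exact inter_hull _ _ (f S) (f T) (hle S T) (hle T S) (heq S T)
  · have := cover_nhds (fun T i => pt u v w (tri T i)) f hd hle heq (by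
      intro T i
      obtain ⟨T', h1, h2⟩ := tri_adj T i
      refine ⟨T', fun j hj => ?_, fun k hk => h2 k (hinj _ _ hk)⟩
      obtain ⟨k, hk⟩ := h1 j hj
      exact ⟨k, by rw [hk]⟩)
    refine Filter.mem_of_superset this (Set.iUnion_subset fun T => ?_)
    exact Set.subset_biUnion_of_mem (u := fun V : Finset (Fin 3 → ℝ) =>
      convexHull ℝ (V : Set (Fin 3 → ℝ))) ((h𝒯 _).2 ⟨T, rfl⟩)
  · intro V hV x hx
    obtain ⟨T, rfl⟩ := (h𝒯 V).1 hV
    rcases mem_tetra.1 hx with rfl | ⟨i, rfl⟩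
    · exact fun i => ⟨0, by simp⟩
    · exact isIntVec_pt hu hv hw _
  · intro V hV
    obtain ⟨T, rfl⟩ := (h𝒯 V).1 hV
    exact volume_tetra _ (hd T)
  · intro V hV
    obtain ⟨T, rfl⟩ := (h𝒯 V).1 hV
    exact mem_tetra.2 (Or.inl rfl)
  · intro V hV x hx y hy hx0 hy0
    obtain ⟨T, rfl⟩ := (h𝒯 V).1 hV
    rcases mem_tetra.1 hx with rfl | ⟨i, rfl⟩
    · exact absurd rfl hx0
    rcases mem_tetra.1 hy with rfl | ⟨j, rfl⟩
    · exact absurd rfl hy0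
    exact hgram T i j

theorem tetra_congr (t : Fin 3 → Fin 3 → ℝ) (a b c : Fin 3 → ℝ) (V : Finset (Fin 3 → ℝ))
    (ha : a = t 0) (hb : b = t 1) (hc : c = t 2) : (V = {0, a, b, c}) ↔ V = tetra t := by
  subst ha hb hc
  rfl

theorem reduced_ineq {M : Matrix (Fin 3) (Fin 3) ℝ} (hM : M.PosDef)
    {u₀ : Fin 3 → Fin 3 → ℝ} (hu₀ : IsReducedBasis M u₀) (s : Fin 3 → ℝ)
    (hs : ∀ i, s i = 1 ∨ s i = -1) (k : Fin 3) (z : Fin 3 → ℝ) (hz : IsIntVec z)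
    (A : Fin 3 → ((Fin 3 → ℝ) →ₗ[ℝ] ℝ))
    (hA : ∀ i j, A i (s j • u₀ j) = if i = j then 1 else 0)
    (l : Fin 3) (hkl : k ≤ l) (hzl : A l z ≠ 0) :
    (s k • u₀ k) ⬝ᵥ M.mulVec (s k • u₀ k) ≤ z ⬝ᵥ M.mulVec z := by
  have h := hu₀.2.2 k z hz (by
    rintro ⟨c, hc, rfl⟩
    apply hzl
    rw [map_sum]
    refine Finset.sum_eq_zero fun i _ => ?_
    rw [map_smul]
    by_cases hil : l = i
    · subst hil
      rw [hc l (by simpa using hkl)]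
      simp
    · have := hA l i
      rw [if_neg hil, map_smul] at this
      rcases hs i with h | h <;> rw [h] at this <;> simp at this <;> simp [this])
  have hnn : 0 ≤ z ⬝ᵥ M.mulVec z := by
    simpa using hM.posSemidef.dotProduct_mulVec_nonneg z
  rw [normM, normM, Real.sqrt_le_sqrt_iff hnn] at h
  rcases hs k with h' | h' <;> simpa [h', Matrix.mulVec_neg] using h
/-- Proposition `propNeigh3`, odd case: explicit construction of an `M`-reduced mesh in
dimension 3 from an `M`-reduced basis, when the signs can be chosen so that
`uᵀMv ≥ 0`, `uᵀMw ≥ 0`, `vᵀMw ≤ 0`. -/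
theorem stmt7 (M : Matrix (Fin 3) (Fin 3) ℝ) (hM : M.PosDef)
    (u₀ : Fin 3 → Fin 3 → ℝ) (hu₀ : IsReducedBasis M u₀)
    (ε₁ ε₂ ε₃ : ℝ) (hε₁ : ε₁ = 1 ∨ ε₁ = -1) (hε₂ : ε₂ = 1 ∨ ε₂ = -1) (hε₃ : ε₃ = 1 ∨ ε₃ = -1)
    (u v w : Fin 3 → ℝ) (hu : u = ε₁ • u₀ 0) (hv : v = ε₂ • u₀ 1) (hw : w = ε₃ • u₀ 2)
    (huv : 0 ≤ u ⬝ᵥ M.mulVec v) (huw : 0 ≤ u ⬝ᵥ M.mulVec w) (hvw : v ⬝ᵥ M.mulVec w ≤ 0)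
    (𝒯 : Finset (Finset (Fin 3 → ℝ)))
    (h𝒯 : 𝒯 =
      {{0, w, u, w + v}, {0, w, w + v, w + v - u}, {0, w, w + v - u, w - u},
       {0, w, w - u, -v}, {0, w, -v, u - v}, {0, w, u - v, u},
       {0, v, w + v, u}, {0, v, w + v - u, w + v}, {0, v, v - u, w + v - u},
       {0, -u, -v, w - u}, {0, -u, w - u, w + v - u}, {0, -u, w + v - u, v - u},
       {0, -w, -u, -(w + v)}, {0, -w, -(w + v), -(w + v - u)}, {0, -w, -(w + v - u), -(w - u)},
       {0, -w, -(w - u), v}, {0, -w, v, -(u - v)}, {0, -w, -(u - v), -u},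
       {0, -v, -(w + v), -u}, {0, -v, -(w + v - u), -(w + v)}, {0, -v, -(v - u), -(w + v - u)},
       {0, u, v, -(w - u)}, {0, u, -(w - u), -(w + v - u)}, {0, u, -(w + v - u), -(v - u)}}) :
    IsReducedMesh M 𝒯 := by
  have hui : ∀ i, IsIntVec (u₀ i) := hu₀.1
  have hsgn : ∀ (e : ℝ) (x : Fin 3 → ℝ), (e = 1 ∨ e = -1) → IsIntVec x → IsIntVec (e • x) := by
    rintro e x he hx i
    obtain ⟨m, hm⟩ := hx i
    rcases he with rfl | rfl
    · exact ⟨m, by simp [hm]⟩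
    · exact ⟨-m, by simp [hm]⟩
  have hu1 : IsIntVec u := hu ▸ hsgn _ _ hε₁ (hui 0)
  have hv1 : IsIntVec v := hv ▸ hsgn _ _ hε₂ (hui 1)
  have hw1 : IsIntVec w := hw ▸ hsgn _ _ hε₃ (hui 2)
  have hdet : |(Matrix.of ![u, v, w]).det| = 1 := by
    have h1 := hu₀.2.1
    have e : (Matrix.of ![u, v, w]).det = ε₁ * ε₂ * ε₃ * (Matrix.of u₀).det := by
      simp [Matrix.det_fin_three, hu, hv, hw]
      ring
    rw [e, abs_mul, h1]
    rcases hε₁ with rfl | rfl <;> rcases hε₂ with rfl | rfl <;> rcases hε₃ with rfl | rfl <;> simp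
  obtain ⟨A, hA, hAx⟩ := exists_dual _ hdet
  have hA0 : ∀ i, A i u = if i = 0 then 1 else 0 := fun i => by simpa using hA i 0
  have hA1 : ∀ i, A i v = if i = 1 then 1 else 0 := fun i => by simpa using hA i 1
  have hA2 : ∀ i, A i w = if i = 2 then 1 else 0 := fun i => by simpa using hA i 2
  have red := reduced_ineq hM hu₀ ![ε₁, ε₂, ε₃] (by
    intro i; fin_cases i <;> simpa) (A := A)
  have hAs : ∀ i j, A i ((![ε₁, ε₂, ε₃] : Fin 3 → ℝ) j • u₀ j) = if i = j then 1 else 0 := by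
    intro i j
    fin_cases j
    · simpa [hu] using hA0 i
    · simpa [hv] using hA1 i
    · simpa [hw] using hA2 i
  have r0 : ∀ p : ℤ × ℤ × ℤ, ∀ l, A l (pt u v w p) ≠ 0 →
      u ⬝ᵥ M.mulVec u ≤ pt u v w p ⬝ᵥ M.mulVec (pt u v w p) := by
    intro p l hl
    have := red 0 _ (isIntVec_pt hu1 hv1 hw1 p) hAs l (Fin.zero_le _) hl
    simpa [← hu] using this
  have r1 : ∀ p : ℤ × ℤ × ℤ, ∀ l, 1 ≤ l → A l (pt u v w p) ≠ 0 →
      v ⬝ᵥ M.mulVec v ≤ pt u v w p ⬝ᵥ M.mulVec (pt u v w p) := by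
    intro p l hl1 hl
    have := red 1 _ (isIntVec_pt hu1 hv1 hw1 p) hAs l hl1 hl
    simpa [← hv] using this
  have r2 : ∀ p : ℤ × ℤ × ℤ, A 2 (pt u v w p) ≠ 0 →
      w ⬝ᵥ M.mulVec w ≤ pt u v w p ⬝ᵥ M.mulVec (pt u v w p) := by
    intro p hl
    have := red 2 _ (isIntVec_pt hu1 hv1 hw1 p) hAs 2 le_rfl hl
    simpa [← hw] using this
  have h0 : 0 ≤ u ⬝ᵥ M.mulVec u := by
    simpa using hM.posSemidef.dotProduct_mulVec_nonneg u
  have h4 := r0 (0, 1, 0) 1 (by simp [pt, hA0, hA1, hA2])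
  have h5 := r1 (0, 0, 1) 2 (by decide) (by simp [pt, hA0, hA1, hA2])
  have h6 := r1 (-1, 1, 0) 1 le_rfl (by simp [pt, hA0, hA1, hA2])
  have h7 := r2 (-1, 0, 1) (by simp [pt, hA0, hA1, hA2])
  have h8 := r2 (0, 1, 1) (by simp [pt, hA0, hA1, hA2])
  have h9 := r2 (-1, 1, 1) (by simp [pt, hA0, hA1, hA2])
  rw [gram_pt hM] at h4 h5 h6 h7 h8 h9
  norm_num at h4 h5 h6 h7 h8 h9
  refine tri_mesh u v w hu1 hv1 hw1 hdet ?_ 𝒯 ?_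
  · intro T i j
    rw [gram_pt hM]
    apply acute_aux <;> linarith
  · intro V
    rw [h𝒯]
    simp only [Finset.mem_insert, Finset.mem_singleton, Fin.exists_fin_succ, IsEmpty.exists_iff,
      or_false]
    repeat' apply or_congr
    all_goals
      apply tetra_congr <;> ext j <;> simp [pt, tri] <;> ring

end
end

section
/- Let M ∈ S_3^+ and let (u_1,u_2,u_3) be an M-reduced basis of ℤ³. Suppose ε_1, ε_2, ε_3 ∈ {−1,1} and a permutation σ of {1,2,3} are such that u := ε_1 u_{σ(1)}, v := ε_2 u_{σ(2)}, w := ε_3 u_{σ(3)} satisfy vᵀ M w ≥ uᵀ M v ≥ uᵀ M w ≥ 0 (this is possible when the number of non-negative scalar products among u_1ᵀMu_2, u_2ᵀMu_3, u_3ᵀMu_1 is even). Then the collection 𝒯 of the 24 tetrahedra having 0 as a vertex together with one of the triplets {u,v,w}, {w,v,w−u}, {w−u,v,v−u}, {w−u,v−u,−u}, {w−u,−u,w−v}, {w−v,−u,−v}, {w−v,−v,u−v}, {w−v,u−v,w−v+u}, {w−v+u,u−v,u}, {u,w,w−v+u}, {w,w−v,w−v+u}, {w,w−u,w−v}, or one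 of their opposites (the opposite of {a,b,c} being {−a,−b,−c}), is an M-reduced mesh. -/
open Matrix
open scoped BigOperators ENNReal Classical

noncomputable section

/-- Coordinates of the 14 vertices in the basis `(u,v,w)`. -/
def PP : Fin 14 → Fin 3 → ℤ :=
  ![![1, 0, 0],
    ![0, 1, 0],
    ![0, 0, 1],
    ![-1, 0, 1],
    ![-1, 1, 0],
    ![-1, 0, 0],
    ![0, -1, 1],
    ![0, -1, 0],
    ![1, -1, 0],
    ![1, -1, 1],
    ![0, 0, -1],
    ![1, 0, -1],
    ![0, 1, -1],
    ![-1, 1, -1]]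

/-- The 24 triplets of vertices. -/
def tt : Fin 24 → Fin 3 → Fin 14 :=
  ![![0, 1, 2],
    ![2, 1, 3],
    ![3, 1, 4],
    ![3, 4, 5],
    ![3, 5, 6],
    ![6, 5, 7],
    ![6, 7, 8],
    ![6, 8, 9],
    ![9, 8, 0],
    ![0, 2, 9],
    ![2, 6, 9],
    ![2, 3, 6],
    ![5, 7, 10],
    ![10, 7, 11],
    ![11, 7, 8],
    ![11, 8, 0],
    ![11, 0, 12],
    ![12, 0, 1],
    ![12, 1, 4],
    ![12, 4, 13],
    ![13, 4, 5],
    ![5, 10, 13],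
    ![10, 12, 13],
    ![10, 11, 12]]

/-- Values at the vertices of a strictly convex piecewise linear function. -/
def cc : Fin 14 → ℤ := ![3, 3, 4, 4, 4, 3, 3, 3, 4, 5, 4, 4, 3, 5]

/-- The linear forms interpolating `cc` on each of the 24 cones. -/
def LL : Fin 24 → Fin 3 → ℤ :=
  ![![3, 3, 4],
    ![0, 3, 4],
    ![-1, 3, 3],
    ![-3, 1, 1],
    ![-3, -2, 1],
    ![-3, -3, 0],
    ![1, -3, 0],
    ![2, -2, 1],
    ![3, -1, 1],
    ![3, 2, 4],
    ![2, 1, 4],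
    ![0, 1, 4],
    ![-3, -3, -4],
    ![0, -3, -4],
    ![1, -3, -3],
    ![3, -1, -1],
    ![3, 2, -1],
    ![3, 3, 0],
    ![-1, 3, 0],
    ![-2, 2, -1],
    ![-3, 1, -1],
    ![-3, -2, -4],
    ![-2, -1, -4],
    ![0, -1, -4]]

/-- Dual bases of the 24 cones. -/
def DD : Fin 24 → Fin 3 → Fin 3 → ℤ :=
  ![![![1, 0, 0], ![0, 1, 0], ![0, 0, 1]],
    ![![1, 0, 1], ![0, 1, 0], ![-1, 0, 0]],
    ![![0, 0, 1], ![1, 1, 1], ![-1, 0, -1]],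
    ![![0, 0, 1], ![0, 1, 0], ![-1, -1, -1]],
    ![![0, 1, 1], ![-1, -1, -1], ![0, -1, 0]],
    ![![0, 0, 1], ![-1, 0, 0], ![0, -1, -1]],
    ![![0, 0, 1], ![-1, -1, -1], ![1, 0, 0]],
    ![![-1, -1, 0], ![0, -1, -1], ![1, 1, 1]],
    ![![0, 0, 1], ![0, -1, -1], ![1, 1, 0]],
    ![![1, 1, 0], ![0, 1, 1], ![0, -1, 0]],
    ![![0, 1, 1], ![-1, -1, 0], ![1, 0, 0]],
    ![![1, 1, 1], ![-1, 0, 0], ![0, -1, 0]],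
    ![![-1, 0, 0], ![0, -1, 0], ![0, 0, -1]],
    ![![-1, 0, -1], ![0, -1, 0], ![1, 0, 0]],
    ![![0, 0, -1], ![-1, -1, -1], ![1, 0, 1]],
    ![![0, 0, -1], ![0, -1, 0], ![1, 1, 1]],
    ![![0, -1, -1], ![1, 1, 1], ![0, 1, 0]],
    ![![0, 0, -1], ![1, 0, 0], ![0, 1, 1]],
    ![![0, 0, -1], ![1, 1, 1], ![-1, 0, 0]],
    ![![1, 1, 0], ![0, 1, 1], ![-1, -1, -1]],
    ![![0, 0, -1], ![0, 1, 1], ![-1, -1, 0]],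
    ![![-1, -1, 0], ![0, -1, -1], ![0, 1, 0]],
    ![![0, -1, -1], ![1, 1, 0], ![-1, 0, 0]],
    ![![-1, -1, -1], ![1, 0, 0], ![0, 1, 0]]]

/-- The neighbour across the facet opposite to a vertex. -/
def nb : Fin 24 → Fin 3 → Fin 24 :=
  ![![1, 9, 17],
    ![2, 11, 0],
    ![18, 3, 1],
    ![20, 4, 2],
    ![5, 11, 3],
    ![12, 6, 4],
    ![14, 7, 5],
    ![8, 10, 6],
    ![15, 9, 7],
    ![10, 8, 0],
    ![7, 9, 11],
    ![4, 10, 1],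
    ![13, 21, 5],
    ![14, 23, 12],
    ![6, 15, 13],
    ![8, 16, 14],
    ![17, 23, 15],
    ![0, 18, 16],
    ![2, 19, 17],
    ![20, 22, 18],
    ![3, 21, 19],
    ![22, 20, 12],
    ![19, 21, 23],
    ![16, 22, 13]]

/-- The slope jumps. -/
def mm : Fin 24 → Fin 3 → ℤ :=
  ![![3, 1, 4],
    ![1, 2, 3],
    ![3, 2, 1],
    ![2, 3, 2],
    ![1, 3, 3],
    ![4, 4, 1],
    ![3, 1, 4],
    ![1, 3, 1],
    ![2, 3, 1],
    ![1, 3, 1],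
    ![3, 1, 2],
    ![3, 2, 2],
    ![3, 1, 4],
    ![1, 2, 3],
    ![3, 2, 1],
    ![2, 3, 2],
    ![1, 3, 3],
    ![4, 4, 1],
    ![3, 1, 4],
    ![1, 3, 1],
    ![2, 3, 1],
    ![1, 3, 1],
    ![3, 1, 2],
    ![3, 2, 2]]

lemma F1 : ∀ i p, ∑ k, LL i k * PP p k ≤ cc p := by decide +kernel

lemma F1a : ∀ i p, ∑ k, LL i k * PP p k = cc p → ∃ j, p = tt i j := by decide +kernel

lemma F1b : ∀ i j, ∑ k, LL i k * PP (tt i j) k = cc (tt i j) := by decide +kernel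

lemma F2 : ∀ i j j', ∑ k, PP (tt i j) k * DD i j' k = if j = j' then 1 else 0 := by
  decide +kernel

lemma F3 : ∀ i k k', ∑ j, DD i j k * PP (tt i j) k' = if k = k' then 1 else 0 := by
  decide +kernel

lemma F4 : ∀ i j k, LL (nb i j) k = LL i k - mm i j * DD i j k := by decide +kernel

lemma F5 : ∀ i j, 0 < mm i j := by decide +kernel

/-- The solid simplex. -/
def SS (n : ℕ) (r : ℝ) : Set (Fin n → ℝ) := {x | (∀ i, 0 ≤ x i) ∧ ∑ i, x i ≤ r}

lemma volume_SS (n : ℕ) : ∀ r : ℝ, 0 ≤ r →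
    MeasureTheory.volume (SS n r) = ENNReal.ofReal (r ^ n / (Nat.factorial n)) := by
  induction n with
  | zero =>
    intro r hr
    have : SS 0 r = Set.univ := by
      ext x; simp [SS, hr]
    rw [this, MeasureTheory.volume_pi, MeasureTheory.Measure.pi_of_empty]
    simp
  | succ n ih =>
    intro r hr
    have hneg : ∀ s : ℝ, s < 0 → SS n s = ∅ := by
      intro s hs
      ext x
      simp only [SS, Set.mem_ofPred_eq, Set.mem_empty_iff_false, iff_false, not_and, not_le]
      intro h
      have := Finset.sum_nonneg (fun i (_ : i ∈ Finset.univ) => h i)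
      linarith
    have hmp := MeasureTheory.volume_preserving_piFinSuccAbove (fun _ : Fin (n + 1) => ℝ) 0
    let A : Set (ℝ × (Fin n → ℝ)) := {p | 0 ≤ p.1 ∧ (∀ i, 0 ≤ p.2 i) ∧ p.1 + ∑ i, p.2 i ≤ r}
    have hA : IsClosed A := by
      apply IsClosed.inter
      · exact isClosed_le continuous_const continuous_fst
      · apply IsClosed.inter
        · have : {p : ℝ × (Fin n → ℝ) | ∀ i, 0 ≤ p.2 i} = ⋂ i, {p | 0 ≤ p.2 i} := by
            ext; simp
          show IsClosed {p : ℝ × (Fin n → ℝ) | ∀ i, 0 ≤ p.2 i}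
          rw [this]
          exact isClosed_iInter fun i => isClosed_le continuous_const (by fun_prop)
        · show IsClosed {p : ℝ × (Fin n → ℝ) | p.1 + ∑ i, p.2 i ≤ r}
          exact isClosed_le (by fun_prop) continuous_const
    have hpre : SS (n + 1) r =
        (MeasurableEquiv.piFinSuccAbove (fun _ : Fin (n + 1) => ℝ) 0) ⁻¹' A := by
      ext x
      simp [SS, A, Fin.forall_fin_succ, Fin.sum_univ_succ, MeasurableEquiv.piFinSuccAbove,
        Fin.insertNthEquiv, and_assoc, Fin.tail]
    rw [hpre, hmp.measure_preimage_equiv, MeasureTheory.Measure.volume_eq_prod,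
      MeasureTheory.Measure.prod_apply hA.measurableSet]
    have hsec : ∀ x : ℝ, MeasureTheory.volume (Prod.mk x ⁻¹' A) =
        (Set.Icc 0 r).indicator (fun x => ENNReal.ofReal ((r - x) ^ n / (Nat.factorial n))) x := by
      intro x
      by_cases hx : x ∈ Set.Icc 0 r
      · rw [Set.indicator_of_mem hx, ← ih (r - x) (by linarith [hx.2])]
        congr 1
        ext y
        simp only [A, SS, Set.mem_preimage, Set.mem_ofPred_eq]
        constructor
        · rintro ⟨_, h, h'⟩; exact ⟨h, by linarith⟩
        · rintro ⟨h, h'⟩; exact ⟨hx.1, h, by linarith⟩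
      · rw [Set.indicator_of_notMem hx]
        have : Prod.mk x ⁻¹' A = ∅ := by
          ext y
          simp only [A, Set.mem_preimage, Set.mem_ofPred_eq, Set.mem_empty_iff_false, iff_false]
          rintro ⟨h0, h, h'⟩
          have := Finset.sum_nonneg (fun i (_ : i ∈ Finset.univ) => h i)
          exact hx ⟨h0, by linarith⟩
        rw [this]; simp
    simp_rw [hsec]
    rw [MeasureTheory.lintegral_indicator measurableSet_Icc,
      ← MeasureTheory.ofReal_integral_eq_lintegral_ofReal]
    · congr 1
      rw [MeasureTheory.integral_Icc_eq_integral_Ioc, ← intervalIntegral.integral_of_le hr,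
        intervalIntegral.integral_div,
        intervalIntegral.integral_comp_sub_left (fun x => x ^ n) r]
      simp only [sub_self, sub_zero, integral_pow]
      rw [Nat.factorial_succ]
      have : (Nat.factorial n : ℝ) ≠ 0 := by positivity
      push_cast
      field_simp
      simp
    · apply Continuous.integrableOn_Icc
      fun_prop
    · refine (MeasureTheory.ae_restrict_iff' measurableSet_Icc).2 (Filter.Eventually.of_forall ?_)
      intro x hx
      have : 0 ≤ r - x := by linarith [hx.2]
      positivity

/-- The vertices, in the standard coordinates. -/
def gg (B : Fin 3 → Fin 3 → ℝ) (p : Fin 14) : Fin 3 → ℝ := ∑ k, (PP p k : ℝ) • B k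

/-- The vertex set of the `i`-th tetrahedron. -/
def VV (B : Fin 3 → Fin 3 → ℝ) (i : Fin 24) : Finset (Fin 3 → ℝ) :=
  insert 0 (Finset.univ.image fun j => gg B (tt i j))

lemma sum_mem_of_zero {E : Type*} [AddCommGroup E] [Module ℝ E] {K : Set E} (hK : Convex ℝ K)
    (h0 : (0 : E) ∈ K) {n : ℕ} (a : Fin n → ℝ) (q : Fin n → E) (ha : ∀ j, 0 ≤ a j)
    (hs : ∑ j, a j ≤ 1) (hq : ∀ j, q j ∈ K) : ∑ j, a j • q j ∈ K := by
  have := hK.sum_mem (t := Finset.univ) (w := (Fin.cons (1 - ∑ j, a j) a : Fin (n+1) → ℝ))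
    (z := (Fin.cons 0 q : Fin (n+1) → E)) ?_ ?_ ?_
  · simpa [Fin.sum_univ_succ] using this
  · intro i _
    refine Fin.cases ?_ (fun i => ?_) i
    · simpa using hs
    · simpa using ha i
  · simp [Fin.sum_univ_succ]
  · intro i _
    refine Fin.cases ?_ (fun i => ?_) i
    · simpa using h0
    · simpa using hq i

/-- The matrix whose rows are the nonzero vertices. -/
def AA (B : Fin 3 → Fin 3 → ℝ) (i : Fin 24) : Matrix (Fin 3) (Fin 3) ℝ :=
  Matrix.of fun j => gg B (tt i j)

lemma convex_SS (n : ℕ) (r : ℝ) : Convex ℝ (SS n r) := by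
  intro x hx y hy a b ha hb hab
  refine ⟨fun i => ?_, ?_⟩
  · have := hx.1 i
    have := hy.1 i
    simp only [Pi.add_apply, Pi.smul_apply, smul_eq_mul]
    positivity
  · simp only [Pi.add_apply, Pi.smul_apply, smul_eq_mul, Finset.sum_add_distrib, ← Finset.mul_sum]
    have h1 := mul_le_mul_of_nonneg_left hx.2 ha
    have h2 := mul_le_mul_of_nonneg_left hy.2 hb
    calc _ ≤ a * r + b * r := by linarith
      _ = r := by rw [← add_mul, hab, one_mul]

lemma toLin_AA (B : Fin 3 → Fin 3 → ℝ) (i : Fin 24) (a : Fin 3 → ℝ) :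
    Matrix.toLin' (AA B i)ᵀ a = ∑ j, a j • gg B (tt i j) := by
  ext k
  simp [Matrix.mulVec, dotProduct, AA, mul_comm]

lemma hull_VV (B : Fin 3 → Fin 3 → ℝ) (i : Fin 24) :
    convexHull ℝ (VV B i : Set (Fin 3 → ℝ)) = Matrix.toLin' (AA B i)ᵀ '' SS 3 1 := by
  apply Set.Subset.antisymm
  · apply convexHull_min
    · intro x hx
      simp only [VV, Finset.coe_insert, Finset.coe_image, Finset.coe_univ, Set.image_univ,
        Set.mem_insert_iff, Set.mem_range] at hx
      rcases hx with rfl | ⟨j, rfl⟩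
      · exact ⟨0, ⟨fun i => le_rfl, by simp⟩, by simp⟩
      · refine ⟨Pi.single j 1, ⟨fun i => ?_, by simp⟩, ?_⟩
        · by_cases h : i = j
          · subst h; simp
          · simp [h]
        · rw [toLin_AA]
          simp [Pi.single_apply]
    · exact (convex_SS 3 1).linear_image _
  · rintro _ ⟨a, ha, rfl⟩
    rw [toLin_AA]
    apply sum_mem_of_zero (convex_convexHull ℝ _) _ _ _ ha.1 ha.2
    · intro j
      apply subset_convexHull
      simp [VV]
    · apply subset_convexHull
      simp [VV]

lemma det_AA (B : Fin 3 → Fin 3 → ℝ) (hB : |(Matrix.of B).det| = 1) (i : Fin 24) :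
    |(AA B i).det| = 1 := by
  have h1 : AA B i = (Matrix.of fun j k => PP (tt i j) k).map (Int.castRingHom ℝ) * Matrix.of B := by
    ext j k
    simp [AA, gg, Matrix.mul_apply]
  have h2 : (Matrix.of fun j k => PP (tt i j) k) * (Matrix.of (DD i))ᵀ = 1 := by
    ext j k
    rw [Matrix.mul_apply, Matrix.one_apply, ← F2 i j k]
    rfl
  have h3 : |(Matrix.of fun j k => PP (tt i j) k).det| = 1 := by
    rw [← Int.isUnit_iff_abs_eq]
    exact IsUnit.of_mul_eq_one _ (by rw [← Matrix.det_mul, h2, Matrix.det_one])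
  rw [h1, Matrix.det_mul, abs_mul, hB, mul_one, ← RingHom.mapMatrix_apply, ← RingHom.map_det]
  simp only [eq_intCast]
  exact_mod_cast h3

lemma volume_VV (B : Fin 3 → Fin 3 → ℝ) (hB : |(Matrix.of B).det| = 1) (i : Fin 24) :
    MeasureTheory.volume (convexHull ℝ (VV B i : Set (Fin 3 → ℝ))) =
      ENNReal.ofReal (1 / (Nat.factorial 3)) := by
  rw [hull_VV, MeasureTheory.Measure.addHaar_image_linearMap, LinearMap.det_toLin',
    Matrix.det_transpose, det_AA B hB i, volume_SS 3 1 zero_le_one]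
  simp

lemma simplex_VV (B : Fin 3 → Fin 3 → ℝ) (hB : |(Matrix.of B).det| = 1) (i : Fin 24) :
    IsSimplex 3 (VV B i) := by
  have hdet : (AA B i).det ≠ 0 := by
    intro h
    have := det_AA B hB i
    rw [h] at this
    simp at this
  have hli : LinearIndependent ℝ (fun j => gg B (tt i j)) :=
    Matrix.linearIndependent_rows_of_det_ne_zero hdet
  let f : Fin 4 → Fin 3 → ℝ := Fin.cons 0 (fun j => gg B (tt i j))
  have hf : AffineIndependent ℝ f := by
    rw [affineIndependent_iff_linearIndependent_vsub ℝ f 0]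
    let e : Fin 3 ≃ {x : Fin 4 // x ≠ 0} := finSuccAboveEquiv 0
    rw [← linearIndependent_equiv e]
    have he : ((fun i : {x : Fin 4 // x ≠ 0} => f i -ᵥ f 0) ∘ e) = fun j => gg B (tt i j) := by
      funext j
      have hj : ((e j : {x : Fin 4 // x ≠ 0}) : Fin 4) = j.succ := by simp [e, finSuccAboveEquiv]
      show f (e j) -ᵥ f 0 = _
      rw [hj]
      simp [f]
    rw [he]
    exact hli
  have hV : VV B i = Finset.univ.image f := by
    ext x
    simp [VV, f, Fin.exists_fin_succ, eq_comm]
  constructor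
  · rw [hV, Finset.card_image_of_injective _ hf.injective]
    simp
  · have h := hf.range
    have hs : Set.range f = (VV B i : Set (Fin 3 → ℝ)) := by
      rw [hV]; simp
    rw [hs] at h
    exact h

lemma exists_coord (B : Fin 3 → Fin 3 → ℝ) (hB : |(Matrix.of B).det| = 1) (x : Fin 3 → ℝ) :
    x = ∑ k, (x ᵥ* (Matrix.of B)⁻¹) k • B k := by
  have hu : IsUnit (Matrix.of B).det := by
    rw [isUnit_iff_ne_zero]; intro h; rw [h] at hB; simp at hB
  have h : (x ᵥ* (Matrix.of B)⁻¹) ᵥ* (Matrix.of B) = x := by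
    rw [Matrix.vecMul_vecMul, Matrix.nonsing_inv_mul _ hu, Matrix.vecMul_one]
  conv_lhs => rw [← h]
  rw [Matrix.vecMul_eq_sum]
  rfl

lemma coord_unique (B : Fin 3 → Fin 3 → ℝ) (hB : |(Matrix.of B).det| = 1) (y z : Fin 3 → ℝ)
    (h : ∑ k, y k • B k = ∑ k, z k • B k) : y = z := by
  have hu : IsUnit (Matrix.of B).det := by
    rw [isUnit_iff_ne_zero]; intro h; rw [h] at hB; simp at hB
  have h' : y ᵥ* (Matrix.of B) = z ᵥ* (Matrix.of B) := by
    rw [Matrix.vecMul_eq_sum, Matrix.vecMul_eq_sum]; exact h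
  have := congrArg (fun t => t ᵥ* (Matrix.of B)⁻¹) h'
  simpa [Matrix.vecMul_vecMul, Matrix.mul_nonsing_inv _ hu] using this

lemma sum_gg (B : Fin 3 → Fin 3 → ℝ) (i : Fin 24) (a : Fin 3 → ℝ) :
    ∑ j, a j • gg B (tt i j) = ∑ k, (∑ j, a j * (PP (tt i j) k : ℝ)) • B k := by
  simp only [gg, Finset.smul_sum, Finset.sum_smul, smul_smul]
  rw [Finset.sum_comm]

lemma form_sum (l : Fin 3 → ℤ) (i : Fin 24) (a : Fin 3 → ℝ) :
    ∑ k, (l k : ℝ) * (∑ j, a j * (PP (tt i j) k : ℝ)) =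
      ∑ j, a j * ((∑ k, l k * PP (tt i j) k : ℤ) : ℝ) := by
  push_cast
  simp only [Finset.mul_sum]
  rw [Finset.sum_comm]
  refine Finset.sum_congr rfl fun j _ => Finset.sum_congr rfl fun k _ => by ring

lemma inter_VV (B : Fin 3 → Fin 3 → ℝ) (hB : |(Matrix.of B).det| = 1) (i i' : Fin 24) :
    (convexHull ℝ (VV B i : Set (Fin 3 → ℝ))) ∩ (convexHull ℝ (VV B i' : Set (Fin 3 → ℝ)))
      = convexHull ℝ ((VV B i ∩ VV B i' : Finset (Fin 3 → ℝ)) : Set (Fin 3 → ℝ)) := by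
  apply Set.Subset.antisymm
  · rintro x ⟨hx, hx'⟩
    rw [hull_VV] at hx hx'
    obtain ⟨a, ha, rfl⟩ := hx
    obtain ⟨b, hb, hab⟩ := hx'
    rw [toLin_AA] at hab ⊢
    rw [toLin_AA] at hab
    have key := coord_unique B hB _ _ (((sum_gg B i' b).symm.trans hab).trans (sum_gg B i a))
    have e1 : ∀ l : Fin 3 → ℤ, ∑ j, b j * ((∑ k, l k * PP (tt i' j) k : ℤ) : ℝ) =
        ∑ j, a j * ((∑ k, l k * PP (tt i j) k : ℤ) : ℝ) := by
      intro l
      rw [← form_sum, ← form_sum]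
      refine Finset.sum_congr rfl fun k _ => ?_
      rw [congrFun key k]
    have e2 := e1 (LL i)
    have e3 := e1 (LL i')
    simp only [F1b] at e2 e3
    have hb0 : ∀ j, 0 ≤ b j *
        ((cc (tt i' j) : ℝ) - ((∑ k, LL i k * PP (tt i' j) k : ℤ) : ℝ)) := by
      intro j
      apply mul_nonneg (hb.1 j)
      rw [sub_nonneg]
      exact_mod_cast F1 i (tt i' j)
    have ha0 : ∀ j, a j * ((∑ k, LL i' k * PP (tt i j) k : ℤ) : ℝ) ≤ a j * (cc (tt i j) : ℝ) := by
      intro j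
      apply mul_le_mul_of_nonneg_left _ (ha.1 j)
      exact_mod_cast F1 i' (tt i j)
    have hsum : ∑ j, b j *
        ((cc (tt i' j) : ℝ) - ((∑ k, LL i k * PP (tt i' j) k : ℤ) : ℝ)) = 0 := by
      apply le_antisymm _ (Finset.sum_nonneg fun j _ => hb0 j)
      simp only [mul_sub, Finset.sum_sub_distrib]
      rw [e2, e3, sub_nonpos]
      exact Finset.sum_le_sum fun j _ => ha0 j
    rw [Finset.sum_eq_zero_iff_of_nonneg (fun j _ => hb0 j)] at hsum
    rw [← hab]
    have h0 : (0 : Fin 3 → ℝ) ∈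
        convexHull ℝ ((VV B i ∩ VV B i' : Finset (Fin 3 → ℝ)) : Set (Fin 3 → ℝ)) := by
      apply subset_convexHull; simp [VV]
    have hrw : ∑ j, b j • gg B (tt i' j) =
        ∑ j, b j • (if b j = 0 then 0 else gg B (tt i' j)) := by
      refine Finset.sum_congr rfl fun j _ => ?_
      split_ifs with h
      · simp [h]
      · rfl
    rw [hrw]
    apply sum_mem_of_zero (convex_convexHull ℝ _) h0 _ _ hb.1 hb.2
    intro j
    split_ifs with h
    · exact h0
    · have h5 := hsum j (Finset.mem_univ j)
      rcases mul_eq_zero.1 h5 with h6 | h6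
      · exact absurd h6 h
      · have h7 : ∑ k, LL i k * PP (tt i' j) k = cc (tt i' j) := by
          have := sub_eq_zero.1 h6
          exact_mod_cast this.symm
        obtain ⟨j', hj'⟩ := F1a i _ h7
        apply subset_convexHull
        rw [Finset.mem_coe, Finset.mem_inter]
        constructor
        · rw [hj']; simp [VV]
        · simp [VV]
  · apply Set.subset_inter
    · exact convexHull_mono (by exact_mod_cast Finset.inter_subset_left)
    · exact convexHull_mono (by exact_mod_cast Finset.inter_subset_right)

lemma nhds_VV (B : Fin 3 → Fin 3 → ℝ) (hB : |(Matrix.of B).det| = 1) :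
    (⋃ i, convexHull ℝ (VV B i : Set (Fin 3 → ℝ))) ∈ nhds (0 : Fin 3 → ℝ) := by
  have hc : ∀ i : Fin 24, ∀ᶠ x in nhds (0 : Fin 3 → ℝ),
      ∑ j, ∑ k, (DD i j k : ℝ) * (x ᵥ* (Matrix.of B)⁻¹) k < 1 := by
    intro i
    have hcont : Continuous fun x : Fin 3 → ℝ =>
        ∑ j, ∑ k, (DD i j k : ℝ) * (x ᵥ* (Matrix.of B)⁻¹) k := by
      simp only [Matrix.vecMul, dotProduct]
      fun_prop
    apply hcont.continuousAt.eventually_lt continuousAt_const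
    simp
  filter_upwards [Filter.eventually_all.2 hc] with x hx
  obtain ⟨i, -, hi⟩ := Finset.exists_max_image Finset.univ
    (fun i : Fin 24 => ∑ k, (LL i k : ℝ) * (x ᵥ* (Matrix.of B)⁻¹) k) Finset.univ_nonempty
  rw [Set.mem_iUnion]
  refine ⟨i, ?_⟩
  rw [hull_VV]
  have hxc := exists_coord B hB x
  generalize x ᵥ* (Matrix.of B)⁻¹ = y at *
  refine ⟨fun j => ∑ k, (DD i j k : ℝ) * y k, ⟨fun j => ?_, (hx i).le⟩, ?_⟩
  · have h := hi (nb i j) (Finset.mem_univ _)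
    have h1 : ∑ k, (LL (nb i j) k : ℝ) * y k =
        ∑ k, (LL i k : ℝ) * y k - (mm i j : ℝ) * ∑ k, (DD i j k : ℝ) * y k := by
      rw [Finset.mul_sum, ← Finset.sum_sub_distrib]
      refine Finset.sum_congr rfl fun k _ => ?_
      rw [F4]; push_cast; ring
    rw [h1] at h
    have hm : (0 : ℝ) < (mm i j : ℝ) := by exact_mod_cast F5 i j
    exact nonneg_of_mul_nonneg_right (by linarith) hm
  · rw [toLin_AA, sum_gg, hxc]
    refine Finset.sum_congr rfl fun k _ => ?_
    congr 1
    have h3 : ∀ k', ∑ j, (DD i j k' : ℝ) * (PP (tt i j) k : ℝ) = if k' = k then 1 else 0 := by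
      intro k'
      exact_mod_cast F3 i k' k
    simp only [Finset.sum_mul]
    rw [Finset.sum_comm]
    calc _ = ∑ k', y k' * ∑ j, (DD i j k' : ℝ) * (PP (tt i j) k : ℝ) := by
            refine Finset.sum_congr rfl fun k' _ => ?_
            rw [Finset.mul_sum]
            exact Finset.sum_congr rfl fun j _ => by ring
      _ = y k := by simp [h3]

lemma gg_int (B : Fin 3 → Fin 3 → ℝ) (hB : ∀ k, IsIntVec (B k)) (p : Fin 14) :
    IsIntVec (gg B p) := by
  intro i
  choose m hm using fun k => hB k i
  refine ⟨∑ k, PP p k * m k, ?_⟩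
  simp [gg, hm]

lemma reduced_le {M : Matrix (Fin 3) (Fin 3) ℝ} (hM : M.PosDef)
    {u₀ : Fin 3 → Fin 3 → ℝ} (hu₀ : IsReducedBasis M u₀) (k : Fin 3) (c : Fin 3 → ℤ)
    (hc : ∃ i : Fin 3, k ≤ i ∧ c i ≠ 0) :
    u₀ k ⬝ᵥ M.mulVec (u₀ k) ≤
      (∑ i, (c i : ℝ) • u₀ i) ⬝ᵥ M.mulVec (∑ i, (c i : ℝ) • u₀ i) := by
  obtain ⟨hint, hdet, hmin⟩ := hu₀
  have hz : IsIntVec (∑ i, (c i : ℝ) • u₀ i) := by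
    intro i
    choose m hm using fun k => hint k i
    exact ⟨∑ k, c k * m k, by simp [hm]⟩
  have := hmin k _ hz ?_
  · unfold normM at this
    rwa [Real.sqrt_le_sqrt_iff] at this
    have := hM.posSemidef.dotProduct_mulVec_nonneg (∑ i, (c i : ℝ) • u₀ i)
    simpa using this
  · rintro ⟨c', h1, h2⟩
    have h3 := coord_unique u₀ hdet _ _ h2
    obtain ⟨i, hi, hi'⟩ := hc
    have h4 := congrFun h3 i
    have h5 := h1 i (by simpa using hi)
    rw [h5] at h4
    exact hi' (by exact_mod_cast h4)

lemma dot_symm {M : Matrix (Fin 3) (Fin 3) ℝ} (hM : M.PosDef) (x y : Fin 3 → ℝ) :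
    x ⬝ᵥ M.mulVec y = y ⬝ᵥ M.mulVec x := by
  have h : Mᵀ = M := by simpa using hM.isHermitian.eq
  rw [Matrix.dotProduct_mulVec, dotProduct_comm, ← Matrix.mulVec_transpose, h]

lemma reduced_pair_aux {M : Matrix (Fin 3) (Fin 3) ℝ} (hM : M.PosDef)
    {u₀ : Fin 3 → Fin 3 → ℝ} (hu₀ : IsReducedBasis M u₀) (i j : Fin 3) (hij : i < j)
    (s : ℤ) (hs : s = 1 ∨ s = -1) :
    2 * s * (u₀ i ⬝ᵥ M.mulVec (u₀ j)) ≤ u₀ i ⬝ᵥ M.mulVec (u₀ i) ∧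
    u₀ i ⬝ᵥ M.mulVec (u₀ i) ≤ u₀ j ⬝ᵥ M.mulVec (u₀ j) := by
  constructor
  · have h := reduced_le hM hu₀ j (Pi.single j 1 - Pi.single i s)
      ⟨j, le_rfl, by simp [hij.ne']⟩
    have e : ∑ k, (((Pi.single j 1 - Pi.single i s : Fin 3 → ℤ) k : ℤ) : ℝ) • u₀ k
        = u₀ j - (s : ℝ) • u₀ i := by
      simp [sub_smul, Finset.sum_sub_distrib, Pi.single_apply, apply_ite (Int.cast : ℤ → ℝ)]
    rw [e] at h
    simp only [Matrix.mulVec_sub, Matrix.mulVec_smul, dotProduct_sub, sub_dotProduct,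
      dotProduct_smul, smul_dotProduct, smul_eq_mul] at h
    rw [dot_symm hM (u₀ j) (u₀ i)] at h
    rcases hs with rfl | rfl <;> push_cast at h ⊢ <;> linarith
  · have h := reduced_le hM hu₀ i (Pi.single j 1) ⟨j, hij.le, by simp⟩
    simpa [Pi.single_apply, apply_ite (Int.cast : ℤ → ℝ)] using h

lemma reduced_pair {M : Matrix (Fin 3) (Fin 3) ℝ} (hM : M.PosDef)
    {u₀ : Fin 3 → Fin 3 → ℝ} (hu₀ : IsReducedBasis M u₀) (i j : Fin 3) (hij : i ≠ j)
    (a b : ℝ) (ha : a = 1 ∨ a = -1) (hb : b = 1 ∨ b = -1) :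
    2 * ((a • u₀ i) ⬝ᵥ M.mulVec (b • u₀ j)) ≤ (a • u₀ i) ⬝ᵥ M.mulVec (a • u₀ i) ∧
    2 * ((a • u₀ i) ⬝ᵥ M.mulVec (b • u₀ j)) ≤ (b • u₀ j) ⬝ᵥ M.mulVec (b • u₀ j) := by
  simp only [Matrix.mulVec_smul, dotProduct_smul, smul_dotProduct, smul_eq_mul]
  rcases lt_or_gt_of_ne hij with h | h
  · have h1 := reduced_pair_aux hM hu₀ i j h 1 (Or.inl rfl)
    have h2 := reduced_pair_aux hM hu₀ i j h (-1) (Or.inr rfl)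
    push_cast at h1 h2
    rcases ha with rfl | rfl <;> rcases hb with rfl | rfl <;> constructor <;> linarith
  · have h1 := reduced_pair_aux hM hu₀ j i h 1 (Or.inl rfl)
    have h2 := reduced_pair_aux hM hu₀ j i h (-1) (Or.inr rfl)
    rw [dot_symm hM (u₀ j) (u₀ i)] at h1 h2
    push_cast at h1 h2
    rcases ha with rfl | rfl <;> rcases hb with rfl | rfl <;> constructor <;> linarith

lemma F6 : ∀ i j j',
    0 ≤ PP (tt i j) 0 * PP (tt i j') 0 ∧
    0 ≤ PP (tt i j) 1 * PP (tt i j') 1 ∧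
    0 ≤ PP (tt i j) 2 * PP (tt i j') 2 ∧
    0 ≤ 2 * (PP (tt i j) 1 * PP (tt i j') 1) + 2 * (PP (tt i j) 2 * PP (tt i j') 2)
      + (PP (tt i j) 1 * PP (tt i j') 2 + PP (tt i j) 2 * PP (tt i j') 1) ∧
    0 ≤ 2 * (PP (tt i j) 0 * PP (tt i j') 0)
      + 2 * (PP (tt i j) 1 * PP (tt i j') 1) + 2 * (PP (tt i j) 2 * PP (tt i j') 2)
      + (PP (tt i j) 1 * PP (tt i j') 2 + PP (tt i j) 2 * PP (tt i j') 1)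
      + (PP (tt i j) 0 * PP (tt i j') 1 + PP (tt i j) 1 * PP (tt i j') 0) ∧
    0 ≤ 2 * (PP (tt i j) 0 * PP (tt i j') 0)
      + 2 * (PP (tt i j) 1 * PP (tt i j') 1) + 2 * (PP (tt i j) 2 * PP (tt i j') 2)
      + (PP (tt i j) 1 * PP (tt i j') 2 + PP (tt i j) 2 * PP (tt i j') 1)
      + (PP (tt i j) 0 * PP (tt i j') 1 + PP (tt i j) 1 * PP (tt i j') 0)
      + (PP (tt i j) 0 * PP (tt i j') 2 + PP (tt i j) 2 * PP (tt i j') 0) := by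
  decide +kernel

/-- Integer Gram data: nonnegativity on each cone. -/
lemma acute_VV {M : Matrix (Fin 3) (Fin 3) ℝ} (hM : M.PosDef) (u v w : Fin 3 → ℝ)
    (huv1 : 2 * (u ⬝ᵥ M.mulVec v) ≤ u ⬝ᵥ M.mulVec u) (huv2 : 2 * (u ⬝ᵥ M.mulVec v) ≤ v ⬝ᵥ M.mulVec v)
    (huw1 : 2 * (u ⬝ᵥ M.mulVec w) ≤ u ⬝ᵥ M.mulVec u) (huw2 : 2 * (u ⬝ᵥ M.mulVec w) ≤ w ⬝ᵥ M.mulVec w)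
    (hvw1 : 2 * (v ⬝ᵥ M.mulVec w) ≤ v ⬝ᵥ M.mulVec v) (hvw2 : 2 * (v ⬝ᵥ M.mulVec w) ≤ w ⬝ᵥ M.mulVec w)
    (h₁ : u ⬝ᵥ M.mulVec v ≤ v ⬝ᵥ M.mulVec w)
    (h₂ : u ⬝ᵥ M.mulVec w ≤ u ⬝ᵥ M.mulVec v)
    (h₃ : 0 ≤ u ⬝ᵥ M.mulVec w) (i : Fin 24) (j j' : Fin 3) :
    0 ≤ gg ![u, v, w] (tt i j) ⬝ᵥ M.mulVec (gg ![u, v, w] (tt i j')) := by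
  have hexp : ∀ p q : Fin 14, gg ![u, v, w] p ⬝ᵥ M.mulVec (gg ![u, v, w] q) =
      ((PP p 0 * PP q 0 : ℤ) : ℝ) * (u ⬝ᵥ M.mulVec u)
      + ((PP p 1 * PP q 1 : ℤ) : ℝ) * (v ⬝ᵥ M.mulVec v)
      + ((PP p 2 * PP q 2 : ℤ) : ℝ) * (w ⬝ᵥ M.mulVec w)
      + ((PP p 0 * PP q 1 + PP p 1 * PP q 0 : ℤ) : ℝ) * (u ⬝ᵥ M.mulVec v)
      + ((PP p 0 * PP q 2 + PP p 2 * PP q 0 : ℤ) : ℝ) * (u ⬝ᵥ M.mulVec w)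
      + ((PP p 1 * PP q 2 + PP p 2 * PP q 1 : ℤ) : ℝ) * (v ⬝ᵥ M.mulVec w) := by
    intro p q
    simp only [gg, Fin.sum_univ_three, Matrix.mulVec_add, Matrix.mulVec_smul, dotProduct_add,
      add_dotProduct, dotProduct_smul, smul_dotProduct, smul_eq_mul, Matrix.cons_val]
    rw [dot_symm hM v u, dot_symm hM w u, dot_symm hM w v]
    push_cast
    ring
  rw [hexp]
  generalize u ⬝ᵥ M.mulVec u = uu at *
  generalize v ⬝ᵥ M.mulVec v = vv at *
  generalize w ⬝ᵥ M.mulVec w = ww at *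
  generalize u ⬝ᵥ M.mulVec v = uv at *
  generalize u ⬝ᵥ M.mulVec w = uw at *
  generalize v ⬝ᵥ M.mulVec w = vw at *
  clear hexp
  obtain ⟨c1, c2, c3, c4, c5, c6⟩ := F6 i j j'
  generalize PP (tt i j) = p at *
  generalize PP (tt i j') = q at *
  have d1 := mul_nonneg (Int.cast_nonneg (R := ℝ) c1) (sub_nonneg.2 huv1)
  have d2 := mul_nonneg (Int.cast_nonneg (R := ℝ) c2) (sub_nonneg.2 hvw1)
  have d3 := mul_nonneg (Int.cast_nonneg (R := ℝ) c3) (sub_nonneg.2 hvw2)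
  have d4 := mul_nonneg (Int.cast_nonneg (R := ℝ) c4) (sub_nonneg.2 h₁)
  have d5 := mul_nonneg (Int.cast_nonneg (R := ℝ) c5) (sub_nonneg.2 h₂)
  have d6 := mul_nonneg (Int.cast_nonneg (R := ℝ) c6) h₃
  push_cast at d1 d2 d3 d4 d5 d6 ⊢
  linarith

lemma VV_list (B : Fin 3 → Fin 3 → ℝ) (i : Fin 24) :
    VV B i = {0, gg B (tt i 0), gg B (tt i 1), gg B (tt i 2)} := by
  ext x
  simp [VV, Fin.exists_fin_succ, eq_comm]


/-- Proposition `propNeigh3`, even case: explicit construction of an `M`-reduced mesh in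
dimension 3 from an `M`-reduced basis, when signs and a permutation can be chosen so that
`vᵀMw ≥ uᵀMv ≥ uᵀMw ≥ 0`. -/
theorem stmt8 (M : Matrix (Fin 3) (Fin 3) ℝ) (hM : M.PosDef)
    (u₀ : Fin 3 → Fin 3 → ℝ) (hu₀ : IsReducedBasis M u₀)
    (ε₁ ε₂ ε₃ : ℝ) (hε₁ : ε₁ = 1 ∨ ε₁ = -1) (hε₂ : ε₂ = 1 ∨ ε₂ = -1) (hε₃ : ε₃ = 1 ∨ ε₃ = -1)
    (σ : Equiv.Perm (Fin 3))
    (u v w : Fin 3 → ℝ)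
    (hu : u = ε₁ • u₀ (σ 0)) (hv : v = ε₂ • u₀ (σ 1)) (hw : w = ε₃ • u₀ (σ 2))
    (h₁ : u ⬝ᵥ M.mulVec v ≤ v ⬝ᵥ M.mulVec w)
    (h₂ : u ⬝ᵥ M.mulVec w ≤ u ⬝ᵥ M.mulVec v)
    (h₃ : 0 ≤ u ⬝ᵥ M.mulVec w)
    (𝒯 : Finset (Finset (Fin 3 → ℝ)))
    (h𝒯 : 𝒯 =
      {{0, u, v, w}, {0, w, v, w - u}, {0, w - u, v, v - u},
       {0, w - u, v - u, -u}, {0, w - u, -u, w - v}, {0, w - v, -u, -v},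
       {0, w - v, -v, u - v}, {0, w - v, u - v, w - v + u}, {0, w - v + u, u - v, u},
       {0, u, w, w - v + u}, {0, w, w - v, w - v + u}, {0, w, w - u, w - v},
       {0, -u, -v, -w}, {0, -w, -v, -(w - u)}, {0, -(w - u), -v, -(v - u)},
       {0, -(w - u), -(v - u), u}, {0, -(w - u), u, -(w - v)}, {0, -(w - v), u, v},
       {0, -(w - v), v, -(u - v)}, {0, -(w - v), -(u - v), -(w - v + u)},
       {0, -(w - v + u), -(u - v), -u},
       {0, -u, -w, -(w - v + u)}, {0, -w, -(w - v), -(w - v + u)}, {0, -w, -(w - u), -(w - v)}}) :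
    IsReducedMesh M 𝒯 := by
  have hd : |(Matrix.of ![u, v, w]).det| = 1 := by
    have e : Matrix.of ![u, v, w] =
        Matrix.diagonal ![ε₁, ε₂, ε₃] * (Matrix.of u₀).submatrix σ id := by
      ext i j
      rw [Matrix.diagonal_mul]
      fin_cases i <;> simp [hu, hv, hw]
    rw [e, Matrix.det_mul, Matrix.det_permute, abs_mul, abs_mul, hu₀.2.1, Matrix.det_diagonal,
      Fin.prod_univ_three]
    have hs : |((Equiv.Perm.sign σ : ℤ) : ℝ)| = 1 := by
      rcases Int.units_eq_one_or (Equiv.Perm.sign σ) with h | h <;> simp [h]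
    rw [hs]
    rcases hε₁ with rfl | rfl <;> rcases hε₂ with rfl | rfl <;> rcases hε₃ with rfl | rfl <;> simp
  have hint : ∀ k, IsIntVec (![u, v, w] k) := by
    have key : ∀ ε : ℝ, (ε = 1 ∨ ε = -1) → ∀ k, IsIntVec (ε • u₀ k) := by
      intro ε hε k i
      obtain ⟨m, hm⟩ := hu₀.1 k i
      rcases hε with rfl | rfl
      · exact ⟨m, by simp [hm]⟩
      · exact ⟨-m, by simp [hm]⟩
    intro k
    fin_cases k
    · simpa [hu] using key ε₁ hε₁ (σ 0)
    · simpa [hv] using key ε₂ hε₂ (σ 1)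
    · simpa [hw] using key ε₃ hε₃ (σ 2)
  have huv := reduced_pair hM hu₀ (σ 0) (σ 1) (by simp) ε₁ ε₂ hε₁ hε₂
  have huw := reduced_pair hM hu₀ (σ 0) (σ 2) (by simp) ε₁ ε₃ hε₁ hε₃
  have hvw := reduced_pair hM hu₀ (σ 1) (σ 2) (by simp) ε₂ ε₃ hε₂ hε₃
  rw [← hu, ← hv] at huv
  rw [← hu, ← hw] at huw
  rw [← hv, ← hw] at hvw
  have hac := acute_VV hM u v w huv.1 huv.2 huw.1 huw.2 hvw.1 hvw.2 h₁ h₂ h₃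
  have hT : 𝒯 = Finset.univ.image (VV ![u, v, w]) := by
    have g0 : gg ![u, v, w] 0 = u := by simp [gg, PP, Fin.sum_univ_three]
    have g1 : gg ![u, v, w] 1 = v := by simp [gg, PP, Fin.sum_univ_three]
    have g2 : gg ![u, v, w] 2 = w := by simp [gg, PP, Fin.sum_univ_three]
    have g3 : gg ![u, v, w] 3 = w - u := by simp [gg, PP, Fin.sum_univ_three]; abel
    have g4 : gg ![u, v, w] 4 = v - u := by simp [gg, PP, Fin.sum_univ_three]; abel
    have g5 : gg ![u, v, w] 5 = -u := by simp [gg, PP, Fin.sum_univ_three]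
    have g6 : gg ![u, v, w] 6 = w - v := by simp [gg, PP, Fin.sum_univ_three]; abel
    have g7 : gg ![u, v, w] 7 = -v := by simp [gg, PP, Fin.sum_univ_three]
    have g8 : gg ![u, v, w] 8 = u - v := by simp [gg, PP, Fin.sum_univ_three]; abel
    have g9 : gg ![u, v, w] 9 = w - v + u := by simp [gg, PP, Fin.sum_univ_three]; abel
    have g10 : gg ![u, v, w] 10 = -w := by simp [gg, PP, Fin.sum_univ_three]
    have g11 : gg ![u, v, w] 11 = u - w := by simp [gg, PP, Fin.sum_univ_three]; abel
    have g12 : gg ![u, v, w] 12 = v - w := by simp [gg, PP, Fin.sum_univ_three]; abel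
    have g13 : gg ![u, v, w] 13 = -(w - v + u) := by simp [gg, PP, Fin.sum_univ_three]; abel
    have hl : Finset.univ.image (VV ![u, v, w]) = (List.ofFn (VV ![u, v, w])).toFinset := by
      ext x
      simp only [Finset.mem_image, Finset.mem_univ, true_and, List.mem_toFinset, List.mem_ofFn,
        Set.mem_range]
    rw [hl, h𝒯]
    simp only [List.ofFn_succ, List.ofFn_zero, List.toFinset_cons, List.toFinset_nil, VV_list,
      neg_sub]
    simp [tt, g0, g1, g2, g3, g4, g5, g6, g7, g8, g9, g10, g11, g12, g13]
  have hTm : ∀ V ∈ 𝒯, ∃ i, V = VV ![u, v, w] i := by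
    intro V hV
    rw [hT, Finset.mem_image] at hV
    obtain ⟨i, -, rfl⟩ := hV
    exact ⟨i, rfl⟩
  refine ⟨⟨?_, ?_⟩, ?_, ?_, ?_, ?_, ?_⟩
  · intro V hV
    obtain ⟨i, rfl⟩ := hTm V hV
    exact simplex_VV _ hd i
  · intro S hS T hT'
    obtain ⟨i, rfl⟩ := hTm S hS
    obtain ⟨i', rfl⟩ := hTm T hT'
    convert inter_VV _ hd i i'
  · refine Filter.mem_of_superset (nhds_VV _ hd) ?_
    apply Set.iUnion_subset
    intro i
    apply Set.subset_biUnion_of_mem (u := fun V : Finset (Fin 3 → ℝ) => convexHull ℝ (V : Set (Fin 3 → ℝ)))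
    rw [hT]
    exact Finset.mem_image_of_mem _ (Finset.mem_univ i)
  · intro V hV x hx
    obtain ⟨i, rfl⟩ := hTm V hV
    simp only [VV, Finset.mem_insert, Finset.mem_image, Finset.mem_univ, true_and] at hx
    rcases hx with rfl | ⟨j, rfl⟩
    · exact fun k => ⟨0, by simp⟩
    · exact gg_int _ hint _
  · intro V hV
    obtain ⟨i, rfl⟩ := hTm V hV
    exact volume_VV _ hd i
  · intro V hV
    obtain ⟨i, rfl⟩ := hTm V hV
    simp [VV]
  · intro V hV x hx y hy hx0 hy0
    obtain ⟨i, rfl⟩ := hTm V hV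
    simp only [VV, Finset.mem_insert, Finset.mem_image, Finset.mem_univ, true_and] at hx hy
    rcases hx with rfl | ⟨j, rfl⟩
    · exact absurd rfl hx0
    rcases hy with rfl | ⟨j', rfl⟩
    · exact absurd rfl hy0
    exact hac i j j'


end
end

section
/- Let d_1, d_2 be positive integers, let M_1 ∈ S_{d_1}^+ and M_2 ∈ S_{d_2}^+, let 𝒯_1 be an M_1-reduced mesh and 𝒯_2 an M_2-reduced mesh, and set d := d_1 + d_2. Let 𝒯 be the d-dimensional mesh defined as follows: for any T_1 ∈ 𝒯_1 with vertices 0 = u¹_0, u¹_1,…,u¹_{d_1} and any T_2 ∈ 𝒯_2 with vertices 0 = u²_0, u²_1,…,u²_{d_2}, the d-dimensional simplex with vertices (0,0), (u¹_1,0),…,(u¹_{d_1},0), (0,u²_1),…,(0,u²_{d_2}) belongs to 𝒯. Then 𝒯 is an M-reduced mesh, where M ∈ S_d^+ is the block-diagonal matrix with diagonal blocks M_1 and M_2. -/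
open Matrix
open scoped BigOperators ENNReal Classical

noncomputable section

open MeasureTheory in
lemma vol_std (d : ℕ) : ∀ r : ℝ, 0 ≤ r →
    volume {x : Fin d → ℝ | (∀ i, 0 ≤ x i) ∧ ∑ i, x i ≤ r} =
      ENNReal.ofReal (r ^ d / (Nat.factorial d)) := by
  induction d with
  | zero =>
    intro r hr
    have : {x : Fin 0 → ℝ | (∀ i, 0 ≤ x i) ∧ ∑ i, x i ≤ r} = Set.univ := by
      ext x; simp [hr]
    rw [this]; simp [volume_pi]
  | succ d ih =>
    intro r hr
    have hmp := (volume_preserving_piFinSuccAbove (fun _ : Fin (d+1) => ℝ) 0).symm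
    have hms : MeasurableSet {x : Fin (d+1) → ℝ | (∀ i, 0 ≤ x i) ∧ ∑ i, x i ≤ r} := by
      apply IsClosed.measurableSet
      rw [Set.ofPred_and]
      apply IsClosed.inter
      · simp only [Set.ofPred_forall]
        exact isClosed_iInter fun i => isClosed_le continuous_const (continuous_apply i)
      · exact isClosed_le (by fun_prop) continuous_const
    rw [← hmp.measure_preimage hms.nullMeasurableSet]
    rw [Measure.volume_eq_prod, Measure.prod_apply (hmp.measurable hms)]
    have key : ∀ t : ℝ, volume (Prod.mk t ⁻¹' ((MeasurableEquiv.piFinSuccAbove (fun _ : Fin (d+1) => ℝ) 0).symm ⁻¹'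
        {x : Fin (d+1) → ℝ | (∀ i, 0 ≤ x i) ∧ ∑ i, x i ≤ r})) =
        (Set.Icc 0 r).indicator (fun t => ENNReal.ofReal ((r - t) ^ d / (Nat.factorial d))) t := by
      intro t
      by_cases ht : t ∈ Set.Icc 0 r
      · rw [Set.indicator_of_mem ht, ← ih (r - t) (by linarith [ht.2])]
        congr 1
        ext y
        simp only [Set.mem_preimage, Set.mem_ofPred_eq, MeasurableEquiv.piFinSuccAbove_symm_apply,
          Fin.insertNthEquiv_zero, Fin.consEquiv_apply, Fin.forall_fin_succ, Fin.sum_univ_succ, Fin.cons_zero, Fin.cons_succ]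
        constructor
        · rintro ⟨⟨_, h⟩, h2⟩; exact ⟨h, by linarith⟩
        · rintro ⟨h, h2⟩; exact ⟨⟨ht.1, h⟩, by linarith⟩
      · rw [Set.indicator_of_notMem ht]
        convert measure_empty (μ := volume)
        ext y
        simp only [Set.mem_preimage, Set.mem_ofPred_eq, MeasurableEquiv.piFinSuccAbove_symm_apply,
          Fin.insertNthEquiv_zero, Fin.consEquiv_apply, Fin.forall_fin_succ, Fin.sum_univ_succ, Fin.cons_zero, Fin.cons_succ,
          Set.mem_empty_iff_false, iff_false]
        rintro ⟨⟨h0, h⟩, h2⟩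
        exact ht ⟨h0, by linarith [Finset.sum_nonneg (fun i (_ : i ∈ Finset.univ) => h i)]⟩
    simp_rw [key]
    rw [lintegral_indicator measurableSet_Icc, ← ofReal_integral_eq_lintegral_ofReal]
    · congr 1
      rw [integral_Icc_eq_integral_Ioc, ← intervalIntegral.integral_of_le hr,
        intervalIntegral.integral_comp_sub_left (fun t => t ^ d / (Nat.factorial d : ℝ)) r]
      simp [Nat.factorial_succ]
      field_simp
    · exact (Continuous.integrableOn_Icc (by fun_prop))
    · filter_upwards [ae_restrict_mem measurableSet_Icc] with t ht
      have : 0 ≤ r - t := by linarith [ht.2]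
      simp only [Pi.zero_apply]
      positivity

lemma hull_eq_image {d : ℕ} (b : Fin d → Fin d → ℝ) :
    convexHull ℝ (insert 0 (Set.range b)) =
      Matrix.toLin' (Matrix.of b)ᵀ '' {x : Fin d → ℝ | (∀ i, 0 ≤ x i) ∧ ∑ i, x i ≤ 1} := by
  have hL : ∀ x : Fin d → ℝ, Matrix.toLin' (Matrix.of b)ᵀ x = ∑ i, x i • b i := by
    intro x
    ext j
    simp [Matrix.mulVec, dotProduct, mul_comm]
  apply Set.Subset.antisymm
  · apply convexHull_min
    · rintro _ (rfl | ⟨i, rfl⟩)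
      · exact ⟨0, by simp, by simp⟩
      · refine ⟨Pi.single i 1, ⟨fun j => ?_, by simp⟩, ?_⟩
        · by_cases h : j = i
          · subst h; simp
          · simp [h]
        · rw [hL]
          simp [Pi.single_apply]
    · apply Convex.linear_image
      rintro x ⟨hx, hx1⟩ y ⟨hy, hy1⟩ s t hs ht hst
      refine ⟨fun i => ?_, ?_⟩
      · have := hx i
        have := hy i
        simp only [Pi.add_apply, Pi.smul_apply, smul_eq_mul]; positivity
      · simp only [Pi.add_apply, Pi.smul_apply, smul_eq_mul, Finset.sum_add_distrib, ← Finset.mul_sum]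
        nlinarith
  · rintro _ ⟨x, ⟨hx, hx1⟩, rfl⟩
    rw [hL]
    have := (convex_convexHull ℝ (insert 0 (Set.range b))).sum_mem (t := (Finset.univ : Finset (Option (Fin d))))
      (w := fun o => o.elim (1 - ∑ i, x i) x) (z := fun o => o.elim 0 b) ?_ ?_ ?_
    · simpa [Fintype.sum_option] using this
    · rintro (_ | i) _
      · simpa using hx1
      · exact hx i
    · simp [Fintype.sum_option]
    · rintro (_ | i) _
      · exact subset_convexHull _ _ (by simp)
      · exact subset_convexHull _ _ (by simp)

open MeasureTheory in
lemma vol_hull {d : ℕ} (b : Fin d → Fin d → ℝ) :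
    volume (convexHull ℝ (insert 0 (Set.range b))) =
      ENNReal.ofReal |(Matrix.of b).det| * ENNReal.ofReal (1 / (Nat.factorial d)) := by
  rw [hull_eq_image, Measure.addHaar_image_linearMap, vol_std d 1 zero_le_one, LinearMap.det_toLin',
    Matrix.det_transpose, one_pow]

lemma exists_enum {d : ℕ} (T : Finset (Fin d → ℝ)) (h0 : (0 : Fin d → ℝ) ∈ T) (hc : T.card = d + 1) :
    ∃ b : Fin d → Fin d → ℝ, (T : Set (Fin d → ℝ)) = insert 0 (Set.range b) := by
  have hc' : (T.erase 0).card = d := by rw [Finset.card_erase_of_mem h0, hc]; rfl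
  let e := (Finset.equivFinOfCardEq hc').symm
  refine ⟨fun i => (e i : Fin d → ℝ), ?_⟩
  have : Set.range (fun i => (e i : Fin d → ℝ)) = ((T.erase 0 : Finset _) : Set (Fin d → ℝ)) := by
    have h := e.surjective.range_comp (Subtype.val : (T.erase 0 : Finset _) → (Fin d → ℝ))
    rw [show (fun i => (e i : Fin d → ℝ)) = Subtype.val ∘ e from rfl, h]
    ext x
    simp [and_comm]
  rw [this, ← Finset.coe_insert, Finset.insert_erase h0]

lemma aff_indep_of_vol {d : ℕ} (V : Finset (Fin d → ℝ)) (hc : V.card = d + 1)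
    (hv : MeasureTheory.volume (convexHull ℝ (V : Set (Fin d → ℝ))) ≠ 0) :
    AffineIndependent ℝ (fun v : V => (v : Fin d → ℝ)) := by
  have htop : affineSpan ℝ (V : Set (Fin d → ℝ)) = ⊤ := by
    by_contra h
    apply hv
    exact MeasureTheory.measure_mono_null (convexHull_subset_affineSpan _)
      (MeasureTheory.Measure.addHaar_affineSubspace _ _ h)
  rw [affineIndependent_iff_finrank_vectorSpan_eq ℝ _ (n := d) (by simpa using hc)]
  have : Set.range (fun v : V => (v : Fin d → ℝ)) = (V : Set (Fin d → ℝ)) := by simp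
  rw [this, ← direction_affineSpan, htop, AffineSubspace.direction_top, finrank_top, Module.finrank_fin_fun]

lemma face_mem {d : ℕ} (S C : Finset (Fin d → ℝ)) (hCS : C ⊆ S)
    (hS : AffineIndependent ℝ (fun v : S => (v : Fin d → ℝ))) (a : Fin d → ℝ)
    (ha : a ∈ convexHull ℝ (S : Set (Fin d → ℝ)))
    (ha' : a ∈ affineSpan ℝ (C : Set (Fin d → ℝ))) :
    a ∈ convexHull ℝ (C : Set (Fin d → ℝ)) := by
  obtain ⟨w, hw0, hw1, hwa⟩ := Finset.mem_convexHull'.1 ha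
  have hsum : ∑ i : S, w i = 1 := by rw [← hw1]; exact Finset.sum_coe_sort S w
  have hcomb : (Finset.univ : Finset S).affineCombination ℝ (fun v : S => (v : Fin d → ℝ))
      (fun i => w i) = a := by
    rw [Finset.affineCombination_eq_linear_combination _ _ _ hsum, ← hwa]
    exact Finset.sum_coe_sort S (fun v => w v • v)
  have himg : (fun v : S => (v : Fin d → ℝ)) '' {v : S | (v : Fin d → ℝ) ∈ C} = (C : Set (Fin d → ℝ)) := by
    ext x
    constructor
    · rintro ⟨v, hv, rfl⟩; exact hv
    · intro hx; exact ⟨⟨x, hCS hx⟩, hx, rfl⟩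
  have hz : ∀ v ∈ S, v ∉ C → w v = 0 := by
    intro v hv hvC
    exact hS.eq_zero_of_affineCombination_mem_affineSpan (fs := Finset.univ) (w := fun i : S => w i) hsum
      (s := {v : S | (v : Fin d → ℝ) ∈ C}) (by rw [hcomb, himg]; exact ha') (i := ⟨v, hv⟩) (Finset.mem_univ _) hvC
  refine Finset.mem_convexHull'.2 ⟨w, fun y hy => hw0 y (hCS hy), ?_, ?_⟩
  · rw [← hw1]; exact Finset.sum_subset hCS hz
  · rw [← hwa]; exact Finset.sum_subset hCS (fun v hv h => by rw [hz v hv h, zero_smul])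

lemma key_inter {d : ℕ} (S S' : Finset (Fin d → ℝ)) (h0 : (0 : Fin d → ℝ) ∈ S) (h0' : (0 : Fin d → ℝ) ∈ S')
    (hS : AffineIndependent ℝ (fun v : S => (v : Fin d → ℝ)))
    (hI : convexHull ℝ (S : Set (Fin d → ℝ)) ∩ convexHull ℝ (S' : Set (Fin d → ℝ)) ⊆
      convexHull ℝ ((S ∩ S' : Finset (Fin d → ℝ)) : Set (Fin d → ℝ)))
    (a a' : Fin d → ℝ) (ha : a ∈ convexHull ℝ (S : Set (Fin d → ℝ)))
    (ha' : a' ∈ convexHull ℝ (S' : Set (Fin d → ℝ))) (s s' : ℝ) (hs : 0 ≤ s) (hss : s ≤ s')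
    (h : s • a = s' • a') :
    ∃ e ∈ convexHull ℝ ((S ∩ S' : Finset (Fin d → ℝ)) : Set (Fin d → ℝ)), s • a = s • e := by
  have h0C : (0 : Fin d → ℝ) ∈ ((S ∩ S' : Finset (Fin d → ℝ)) : Set (Fin d → ℝ)) := by simp [h0, h0']
  rcases hs.eq_or_lt with rfl | hs
  · exact ⟨0, subset_convexHull _ _ h0C, by simp⟩
  refine ⟨a, ?_, rfl⟩
  have hs' : 0 < s' := hs.trans_le hss
  have e1 : a' = (s / s') • a := by
    rw [div_eq_inv_mul, mul_smul, h, smul_smul, inv_mul_cancel₀ hs'.ne', one_smul]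
  have e2 : a = (s' / s) • a' := by
    rw [div_eq_inv_mul, mul_smul, ← h, smul_smul, inv_mul_cancel₀ hs.ne', one_smul]
  have m1 : a' ∈ convexHull ℝ (S : Set (Fin d → ℝ)) := by
    rw [e1]
    exact (convex_convexHull ℝ _).smul_mem_of_zero_mem (subset_convexHull _ _ h0) ha
      ⟨by positivity, (div_le_one hs').2 hss⟩
  have m2 := convexHull_subset_affineSpan _ (hI ⟨m1, ha'⟩)
  apply face_mem S _ Finset.inter_subset_left hS a ha
  have := AffineMap.lineMap_mem (s' / s) (subset_affineSpan ℝ _ h0C) m2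
  rw [e2]
  simpa [AffineMap.lineMap_apply] using this

/-- embedding of the first factor -/
def J1 (d₁ d₂ : ℕ) : (Fin d₁ → ℝ) →ₗ[ℝ] (Fin (d₁ + d₂) → ℝ) where
  toFun v := Fin.append v 0
  map_add' x y := by
    ext i; refine Fin.addCases (fun i => ?_) (fun i => ?_) i <;> simp
  map_smul' c x := by
    ext i; refine Fin.addCases (fun i => ?_) (fun i => ?_) i <;> simp

/-- embedding of the second factor -/
def J2 (d₁ d₂ : ℕ) : (Fin d₂ → ℝ) →ₗ[ℝ] (Fin (d₁ + d₂) → ℝ) where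
  toFun v := Fin.append 0 v
  map_add' x y := by
    ext i; refine Fin.addCases (fun i => ?_) (fun i => ?_) i <;> simp
  map_smul' c x := by
    ext i; refine Fin.addCases (fun i => ?_) (fun i => ?_) i <;> simp

/-- the product simplex -/
def PV {d₁ d₂ : ℕ} (T₁ : Finset (Fin d₁ → ℝ)) (T₂ : Finset (Fin d₂ → ℝ)) :
    Finset (Fin (d₁ + d₂) → ℝ) :=
  T₁.image (fun v => Fin.append v (0 : Fin d₂ → ℝ))
          ∪ T₂.image (fun w => Fin.append (0 : Fin d₁ → ℝ) w)

lemma append_inj' {d₁ d₂ : ℕ} {a a' : Fin d₁ → ℝ} {c c' : Fin d₂ → ℝ}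
    (h : Fin.append a c = Fin.append a' c') : a = a' ∧ c = c' := by
  constructor
  · ext i; simpa using congrFun h (Fin.castAdd d₂ i)
  · ext i; simpa using congrFun h (Fin.natAdd d₁ i)

lemma append_zero_zero (d₁ d₂ : ℕ) : Fin.append (0 : Fin d₁ → ℝ) (0 : Fin d₂ → ℝ) = 0 :=
  (J1 d₁ d₂).map_zero

lemma J_add {d₁ d₂ : ℕ} (a : Fin d₁ → ℝ) (c : Fin d₂ → ℝ) :
    J1 d₁ d₂ a + J2 d₁ d₂ c = Fin.append a c := by
  ext i; refine Fin.addCases (fun i => ?_) (fun i => ?_) i <;> simp [J1, J2]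

lemma PV_coe {d₁ d₂ : ℕ} (T₁ : Finset (Fin d₁ → ℝ)) (T₂ : Finset (Fin d₂ → ℝ)) :
    (PV T₁ T₂ : Set (Fin (d₁ + d₂) → ℝ)) = J1 d₁ d₂ '' T₁ ∪ J2 d₁ d₂ '' T₂ := by
  simp [PV, J1, J2]

lemma mem_PV {d₁ d₂ : ℕ} {T₁ : Finset (Fin d₁ → ℝ)} {T₂ : Finset (Fin d₂ → ℝ)}
    {z : Fin (d₁ + d₂) → ℝ} : z ∈ PV T₁ T₂ ↔
      (∃ v ∈ T₁, Fin.append v 0 = z) ∨ (∃ w ∈ T₂, Fin.append 0 w = z) := by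
  simp [PV]

lemma zero_mem_PV {d₁ d₂ : ℕ} {T₁ : Finset (Fin d₁ → ℝ)} {T₂ : Finset (Fin d₂ → ℝ)}
    (h : 0 ∈ T₁) : (0 : Fin (d₁ + d₂) → ℝ) ∈ PV T₁ T₂ :=
  mem_PV.2 (Or.inl ⟨0, h, append_zero_zero _ _⟩)

lemma mem_hull_PV {d₁ d₂ : ℕ} {T₁ : Finset (Fin d₁ → ℝ)} {T₂ : Finset (Fin d₂ → ℝ)}
    (h1 : 0 ∈ T₁) (h2 : 0 ∈ T₂) {z : Fin (d₁ + d₂) → ℝ}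
    (hz : z ∈ convexHull ℝ (PV T₁ T₂ : Set (Fin (d₁ + d₂) → ℝ))) :
    ∃ s t : ℝ, 0 ≤ s ∧ 0 ≤ t ∧ s + t = 1 ∧ ∃ a ∈ convexHull ℝ (T₁ : Set (Fin d₁ → ℝ)),
      ∃ c ∈ convexHull ℝ (T₂ : Set (Fin d₂ → ℝ)), z = Fin.append (s • a) (t • c) := by
  rw [PV_coe, convexHull_union ⟨_, Set.mem_image_of_mem _ h1⟩ ⟨_, Set.mem_image_of_mem _ h2⟩,
    ← LinearMap.image_convexHull, ← LinearMap.image_convexHull, mem_convexJoin] at hz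
  obtain ⟨_, ⟨a, ha, rfl⟩, _, ⟨c, hc, rfl⟩, s, t, hs, ht, hst, rfl⟩ := hz
  refine ⟨s, t, hs, ht, hst, a, ha, c, hc, ?_⟩
  rw [← J_add, map_smul, map_smul]

lemma mem_hull_PV' {d₁ d₂ : ℕ} {T₁ : Finset (Fin d₁ → ℝ)} {T₂ : Finset (Fin d₂ → ℝ)}
    (h1 : 0 ∈ T₁) {s t : ℝ} (hs : 0 ≤ s) (ht : 0 ≤ t) (hst : s + t ≤ 1)
    {a : Fin d₁ → ℝ} (ha : a ∈ convexHull ℝ (T₁ : Set (Fin d₁ → ℝ)))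
    {c : Fin d₂ → ℝ} (hc : c ∈ convexHull ℝ (T₂ : Set (Fin d₂ → ℝ))) :
    Fin.append (s • a) (t • c) ∈ convexHull ℝ (PV T₁ T₂ : Set (Fin (d₁ + d₂) → ℝ)) := by
  have ha' : J1 d₁ d₂ a ∈ convexHull ℝ (PV T₁ T₂ : Set (Fin (d₁ + d₂) → ℝ)) := by
    apply convexHull_mono (s := J1 d₁ d₂ '' T₁)
    · rw [PV_coe]; exact Set.subset_union_left
    · rw [← LinearMap.image_convexHull]; exact ⟨a, ha, rfl⟩
  have hc' : J2 d₁ d₂ c ∈ convexHull ℝ (PV T₁ T₂ : Set (Fin (d₁ + d₂) → ℝ)) := by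
    apply convexHull_mono (s := J2 d₁ d₂ '' T₂)
    · rw [PV_coe]; exact Set.subset_union_right
    · rw [← LinearMap.image_convexHull]; exact ⟨c, hc, rfl⟩
  have h0 : (0 : Fin (d₁ + d₂) → ℝ) ∈ convexHull ℝ (PV T₁ T₂ : Set (Fin (d₁ + d₂) → ℝ)) :=
    subset_convexHull _ _ (zero_mem_PV h1)
  have := (convex_convexHull ℝ (PV T₁ T₂ : Set (Fin (d₁ + d₂) → ℝ))).sum_mem
    (t := (Finset.univ : Finset (Fin 3))) (w := ![s, t, 1 - s - t])
    (z := ![J1 d₁ d₂ a, J2 d₁ d₂ c, 0]) ?_ ?_ ?_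
  · rw [← J_add, map_smul, map_smul]
    simpa [Fin.sum_univ_three] using this
  · intro i _; fin_cases i
    · exact hs
    · exact ht
    · show 0 ≤ 1 - s - t
      linarith
  · simp [Fin.sum_univ_three]
  · intro i _; fin_cases i
    · exact ha'
    · exact hc'
    · exact h0

lemma PV_inter {d₁ d₂ : ℕ} {T₁ S₁ : Finset (Fin d₁ → ℝ)} {T₂ S₂ : Finset (Fin d₂ → ℝ)}
    (h1 : 0 ∈ T₁) (k1 : 0 ∈ S₁) :
    PV T₁ T₂ ∩ PV S₁ S₂ = PV (T₁ ∩ S₁) (T₂ ∩ S₂) := by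
  have hz : ∀ z : Fin (d₁ + d₂) → ℝ, z = 0 → z ∈ PV (T₁ ∩ S₁) (T₂ ∩ S₂) := by
    rintro _ rfl
    exact zero_mem_PV (Finset.mem_inter.2 ⟨h1, k1⟩)
  ext z
  rw [Finset.mem_inter]
  constructor
  · rintro ⟨hT, hS⟩
    rcases mem_PV.1 hT with ⟨v, hv, rfl⟩ | ⟨v, hv, rfl⟩ <;>
      rcases mem_PV.1 hS with ⟨w, hw, hvw⟩ | ⟨w, hw, hvw⟩
    · obtain ⟨rfl, -⟩ := append_inj' hvw
      exact mem_PV.2 (Or.inl ⟨w, Finset.mem_inter.2 ⟨hv, hw⟩, rfl⟩)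
    · obtain ⟨rfl, -⟩ := append_inj' hvw
      exact hz _ (append_zero_zero _ _)
    · obtain ⟨-, rfl⟩ := append_inj' hvw
      exact hz _ (append_zero_zero _ _)
    · obtain ⟨-, rfl⟩ := append_inj' hvw
      exact mem_PV.2 (Or.inr ⟨w, Finset.mem_inter.2 ⟨hv, hw⟩, rfl⟩)
  · intro h
    rcases mem_PV.1 h with ⟨v, hv, rfl⟩ | ⟨v, hv, rfl⟩
    · rw [Finset.mem_inter] at hv
      exact ⟨mem_PV.2 (Or.inl ⟨v, hv.1, rfl⟩), mem_PV.2 (Or.inl ⟨v, hv.2, rfl⟩)⟩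
    · rw [Finset.mem_inter] at hv
      exact ⟨mem_PV.2 (Or.inr ⟨v, hv.1, rfl⟩), mem_PV.2 (Or.inr ⟨v, hv.2, rfl⟩)⟩

lemma PV_card {d₁ d₂ : ℕ} {T₁ : Finset (Fin d₁ → ℝ)} {T₂ : Finset (Fin d₂ → ℝ)}
    (h1 : 0 ∈ T₁) (h2 : 0 ∈ T₂) (c1 : T₁.card = d₁ + 1) (c2 : T₂.card = d₂ + 1) :
    (PV T₁ T₂).card = d₁ + d₂ + 1 := by
  have hi : T₁.image (fun v => Fin.append v (0 : Fin d₂ → ℝ))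
          ∩ T₂.image (fun w => Fin.append (0 : Fin d₁ → ℝ) w) = {0} := by
    ext z
    simp only [Finset.mem_inter, Finset.mem_image, Finset.mem_singleton]
    constructor
    · rintro ⟨⟨v, -, rfl⟩, ⟨w, -, hw⟩⟩
      obtain ⟨rfl, -⟩ := append_inj' hw
      exact append_zero_zero _ _
    · rintro rfl
      exact ⟨⟨0, h1, append_zero_zero _ _⟩, ⟨0, h2, append_zero_zero _ _⟩⟩
  have := Finset.card_union_add_card_inter (T₁.image (fun v => Fin.append v (0 : Fin d₂ → ℝ)))
    (T₂.image (fun w => Fin.append (0 : Fin d₁ → ℝ) w))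
  rw [hi, Finset.card_image_of_injective _ (fun a b h => (append_inj' h).1),
    Finset.card_image_of_injective _ (fun a b h => (append_inj' h).2), c1, c2,
    Finset.card_singleton] at this
  unfold PV
  omega

lemma abs_det_one {d : ℕ} (b : Fin d → Fin d → ℝ)
    (h : MeasureTheory.volume (convexHull ℝ (insert 0 (Set.range b)))
      = ENNReal.ofReal (1 / (Nat.factorial d))) : |(Matrix.of b).det| = 1 := by
  rw [vol_hull, ← ENNReal.ofReal_mul (abs_nonneg _),
    ENNReal.ofReal_eq_ofReal_iff (by positivity) (by positivity)] at h
  have : (1 / (Nat.factorial d) : ℝ) ≠ 0 := by positivity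
  exact mul_right_cancel₀ this (by rw [h, one_mul])

lemma PV_vol {d₁ d₂ : ℕ} {T₁ : Finset (Fin d₁ → ℝ)} {T₂ : Finset (Fin d₂ → ℝ)}
    (h1 : 0 ∈ T₁) (h2 : 0 ∈ T₂) (c1 : T₁.card = d₁ + 1) (c2 : T₂.card = d₂ + 1)
    (v1 : MeasureTheory.volume (convexHull ℝ (T₁ : Set (Fin d₁ → ℝ)))
      = ENNReal.ofReal (1 / (Nat.factorial d₁)))
    (v2 : MeasureTheory.volume (convexHull ℝ (T₂ : Set (Fin d₂ → ℝ)))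
      = ENNReal.ofReal (1 / (Nat.factorial d₂))) :
    MeasureTheory.volume (convexHull ℝ (PV T₁ T₂ : Set (Fin (d₁ + d₂) → ℝ)))
      = ENNReal.ofReal (1 / (Nat.factorial (d₁ + d₂))) := by
  obtain ⟨b₁, hb₁⟩ := exists_enum T₁ h1 c1
  obtain ⟨b₂, hb₂⟩ := exists_enum T₂ h2 c2
  have e1 := abs_det_one b₁ (hb₁ ▸ v1)
  have e2 := abs_det_one b₂ (hb₂ ▸ v2)
  let b : Fin (d₁ + d₂) → Fin (d₁ + d₂) → ℝ :=
    Fin.append (fun i => J1 d₁ d₂ (b₁ i)) (fun j => J2 d₁ d₂ (b₂ j))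
  have hb : (PV T₁ T₂ : Set (Fin (d₁ + d₂) → ℝ)) = insert 0 (Set.range b) := by
    rw [PV_coe, hb₁, hb₂, Set.image_insert_eq, Set.image_insert_eq, map_zero, map_zero]
    have : Set.range b = J1 d₁ d₂ '' Set.range b₁ ∪ J2 d₁ d₂ '' Set.range b₂ := by
      ext z
      constructor
      · rintro ⟨i, rfl⟩
        refine Fin.addCases (fun i => ?_) (fun i => ?_) i
        · left; simp [b]
        · right; simp [b]
      · rintro (⟨_, ⟨i, rfl⟩, rfl⟩ | ⟨_, ⟨i, rfl⟩, rfl⟩)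
        · exact ⟨Fin.castAdd d₂ i, by simp [b]⟩
        · exact ⟨Fin.natAdd d₁ i, by simp [b]⟩
    rw [this]
    ext z
    simp only [Set.mem_union, Set.mem_insert_iff]
    tauto
  have hm : Matrix.of b = Matrix.reindex finSumFinEquiv finSumFinEquiv
      (Matrix.fromBlocks (Matrix.of b₁) 0 0 (Matrix.of b₂)) := by
    ext i j
    refine Fin.addCases (fun i => ?_) (fun i => ?_) i <;>
      refine Fin.addCases (fun j => ?_) (fun j => ?_) j <;> simp [b, J1, J2]
  rw [hb, vol_hull, hm, Matrix.det_reindex_self, Matrix.det_fromBlocks_zero₂₁, abs_mul, e1, e2]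
  simp

lemma block_mulVec {d₁ d₂ : ℕ} (M₁ : Matrix (Fin d₁) (Fin d₁) ℝ) (M₂ : Matrix (Fin d₂) (Fin d₂) ℝ)
    (a a' : Fin d₁ → ℝ) (c c' : Fin d₂ → ℝ) :
    Fin.append a c ⬝ᵥ (Matrix.reindex finSumFinEquiv finSumFinEquiv
      (Matrix.fromBlocks M₁ 0 0 M₂)).mulVec (Fin.append a' c') =
      a ⬝ᵥ M₁.mulVec a' + c ⬝ᵥ M₂.mulVec c' := by
  simp [dotProduct, Matrix.mulVec, Fin.sum_univ_add]

lemma PV_mesh {d₁ d₂ : ℕ} {T₁ S₁ : Finset (Fin d₁ → ℝ)} {T₂ S₂ : Finset (Fin d₂ → ℝ)}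
    (h1 : 0 ∈ T₁) (h2 : 0 ∈ T₂) (k1 : 0 ∈ S₁) (k2 : 0 ∈ S₂)
    (aT₁ : AffineIndependent ℝ (fun v : T₁ => (v : Fin d₁ → ℝ)))
    (aS₂ : AffineIndependent ℝ (fun v : S₂ => (v : Fin d₂ → ℝ)))
    (hI₁ : convexHull ℝ (T₁ : Set (Fin d₁ → ℝ)) ∩ convexHull ℝ (S₁ : Set (Fin d₁ → ℝ)) =
      convexHull ℝ ((T₁ ∩ S₁ : Finset (Fin d₁ → ℝ)) : Set (Fin d₁ → ℝ)))
    (hI₂ : convexHull ℝ (S₂ : Set (Fin d₂ → ℝ)) ∩ convexHull ℝ (T₂ : Set (Fin d₂ → ℝ)) =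
      convexHull ℝ ((S₂ ∩ T₂ : Finset (Fin d₂ → ℝ)) : Set (Fin d₂ → ℝ)))
    {s t s' t' : ℝ} (hs : 0 ≤ s) (ht' : 0 ≤ t') (hst : s + t = 1) (hst' : s' + t' = 1)
    (hss : s ≤ s') {a a' : Fin d₁ → ℝ} {c c' : Fin d₂ → ℝ}
    (ha : a ∈ convexHull ℝ (T₁ : Set (Fin d₁ → ℝ))) (ha' : a' ∈ convexHull ℝ (S₁ : Set (Fin d₁ → ℝ)))
    (hc : c ∈ convexHull ℝ (T₂ : Set (Fin d₂ → ℝ))) (hc' : c' ∈ convexHull ℝ (S₂ : Set (Fin d₂ → ℝ)))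
    (hac : Fin.append (s • a) (t • c) = Fin.append (s' • a') (t' • c')) :
    Fin.append (s • a) (t • c) ∈
      convexHull ℝ ((PV T₁ T₂ ∩ PV S₁ S₂ : Finset _) : Set (Fin (d₁ + d₂) → ℝ)) := by
  obtain ⟨e1, e2⟩ := append_inj' hac
  obtain ⟨e, he, hae⟩ := key_inter T₁ S₁ h1 k1 aT₁ hI₁.subset a a' ha ha' s s' hs hss e1
  obtain ⟨f, hf, hcf⟩ := key_inter S₂ T₂ k2 h2 aS₂ hI₂.subset c' c hc' hc t' t ht' (by linarith) e2.symm
  rw [PV_inter h1 k1, e2, hae, hcf]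
  rw [Finset.inter_comm] at hf
  exact mem_hull_PV' (Finset.mem_inter.2 ⟨h1, k1⟩) hs ht' (by linarith) he hf

/-- Remark `diagonal`: the product of an `M₁`-reduced mesh and an `M₂`-reduced mesh is an
`M`-reduced mesh for the block diagonal matrix `M` with blocks `M₁`, `M₂`. -/
theorem stmt9 (d₁ d₂ : ℕ) (hd₁ : 0 < d₁) (hd₂ : 0 < d₂)
    (M₁ : Matrix (Fin d₁) (Fin d₁) ℝ) (M₂ : Matrix (Fin d₂) (Fin d₂) ℝ)
    (hM₁ : M₁.PosDef) (hM₂ : M₂.PosDef)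
    (𝒯₁ : Finset (Finset (Fin d₁ → ℝ))) (𝒯₂ : Finset (Finset (Fin d₂ → ℝ)))
    (h𝒯₁ : IsReducedMesh M₁ 𝒯₁) (h𝒯₂ : IsReducedMesh M₂ 𝒯₂)
    (M : Matrix (Fin (d₁ + d₂)) (Fin (d₁ + d₂)) ℝ)
    (hM : M = Matrix.reindex finSumFinEquiv finSumFinEquiv (Matrix.fromBlocks M₁ 0 0 M₂))
    (𝒯 : Finset (Finset (Fin (d₁ + d₂) → ℝ)))
    (h𝒯 : ∀ V : Finset (Fin (d₁ + d₂) → ℝ), V ∈ 𝒯 ↔ ∃ T₁ ∈ 𝒯₁, ∃ T₂ ∈ 𝒯₂,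
      V = T₁.image (fun v => Fin.append v (0 : Fin d₂ → ℝ))
          ∪ T₂.image (fun w => Fin.append (0 : Fin d₁ → ℝ) w)) :
    IsReducedMesh M 𝒯 := by
  obtain ⟨⟨simp₁, int₁⟩, nh₁, iv₁, vol₁, z₁, sc₁⟩ := h𝒯₁
  obtain ⟨⟨simp₂, int₂⟩, nh₂, iv₂, vol₂, z₂, sc₂⟩ := h𝒯₂
  have hPV : ∀ V : Finset (Fin (d₁ + d₂) → ℝ), V ∈ 𝒯 ↔ ∃ T₁ ∈ 𝒯₁, ∃ T₂ ∈ 𝒯₂, V = PV T₁ T₂ := h𝒯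
  clear h𝒯
  have hvol : ∀ V ∈ 𝒯, MeasureTheory.volume (convexHull ℝ (V : Set (Fin (d₁ + d₂) → ℝ)))
      = ENNReal.ofReal (1 / (Nat.factorial (d₁ + d₂))) := by
    intro V hV
    obtain ⟨T₁, hT₁, T₂, hT₂, rfl⟩ := (hPV V).1 hV
    exact PV_vol (z₁ _ hT₁) (z₂ _ hT₂) (simp₁ _ hT₁).1 (simp₂ _ hT₂).1 (vol₁ _ hT₁) (vol₂ _ hT₂)
  refine ⟨⟨?_, ?_⟩, ?_, ?_, hvol, ?_, ?_⟩
  · intro V hV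
    have hv := hvol V hV
    obtain ⟨T₁, hT₁, T₂, hT₂, rfl⟩ := (hPV V).1 hV
    have hc := PV_card (z₁ _ hT₁) (z₂ _ hT₂) (simp₁ _ hT₁).1 (simp₂ _ hT₂).1
    refine ⟨hc, aff_indep_of_vol _ hc ?_⟩
    rw [hv]
    have : (0 : ℝ) < 1 / (Nat.factorial (d₁ + d₂)) := by positivity
    simpa using this.ne'
  · intro V hV W hW
    obtain ⟨T₁, hT₁, T₂, hT₂, rfl⟩ := (hPV V).1 hV
    obtain ⟨S₁, hS₁, S₂, hS₂, rfl⟩ := (hPV W).1 hW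
    apply Set.Subset.antisymm
    · rintro z ⟨hz, hz'⟩
      obtain ⟨s, t, hs, ht, hst, a, ha, c, hc, e⟩ := mem_hull_PV (z₁ _ hT₁) (z₂ _ hT₂) hz
      obtain ⟨s', t', hs', ht', hst', a', ha', c', hc', e'⟩ := mem_hull_PV (z₁ _ hS₁) (z₂ _ hS₂) hz'
      rcases le_total s s' with hss | hss
      · rw [e]
        exact PV_mesh (z₁ _ hT₁) (z₂ _ hT₂) (z₁ _ hS₁) (z₂ _ hS₂) (simp₁ _ hT₁).2 (simp₂ _ hS₂).2
          (int₁ _ hT₁ _ hS₁) (int₂ _ hS₂ _ hT₂) hs ht' hst hst' hss ha ha' hc hc' (e.symm.trans e')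
      · rw [e', Finset.inter_comm]
        exact PV_mesh (z₁ _ hS₁) (z₂ _ hS₂) (z₁ _ hT₁) (z₂ _ hT₂) (simp₁ _ hS₁).2 (simp₂ _ hT₂).2
          (int₁ _ hS₁ _ hT₁) (int₂ _ hT₂ _ hS₂) hs' ht hst' hst hss ha' ha hc' hc (e'.symm.trans e)
    · apply Set.subset_inter
      · exact convexHull_mono (Finset.coe_subset.2 Finset.inter_subset_left)
      · exact convexHull_mono (Finset.coe_subset.2 Finset.inter_subset_right)
  · have c1 : Continuous (fun (z : Fin (d₁ + d₂) → ℝ) (i : Fin d₁) => 2 * z (Fin.castAdd d₂ i)) := by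
      fun_prop
    have c2 : Continuous (fun (z : Fin (d₁ + d₂) → ℝ) (i : Fin d₂) => 2 * z (Fin.natAdd d₁ i)) := by
      fun_prop
    have n1 := c1.continuousAt.preimage_mem_nhds (x := 0) (by
      convert nh₁ using 2; ext i; simp)
    have n2 := c2.continuousAt.preimage_mem_nhds (x := 0) (by
      convert nh₂ using 2; ext i; simp)
    filter_upwards [n1, n2] with z hz1 hz2
    simp only [Set.mem_preimage, Set.mem_iUnion] at hz1 hz2 ⊢
    obtain ⟨T₁, hT₁, hz1⟩ := hz1
    obtain ⟨T₂, hT₂, hz2⟩ := hz2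
    refine ⟨PV T₁ T₂, (hPV _).2 ⟨T₁, hT₁, T₂, hT₂, rfl⟩, ?_⟩
    have := mem_hull_PV' (z₁ _ hT₁) (s := 1/2) (t := 1/2) (by norm_num) (by norm_num) (by norm_num)
      hz1 hz2
    convert this using 1
    ext i
    refine Fin.addCases (fun i => ?_) (fun i => ?_) i <;> simp
  · intro V hV v hv
    obtain ⟨T₁, hT₁, T₂, hT₂, rfl⟩ := (hPV V).1 hV
    rcases mem_PV.1 hv with ⟨w, hw, rfl⟩ | ⟨w, hw, rfl⟩
    · intro i
      refine Fin.addCases (fun i => ?_) (fun i => ?_) i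
      · simpa using iv₁ _ hT₁ w hw i
      · exact ⟨0, by simp⟩
    · intro i
      refine Fin.addCases (fun i => ?_) (fun i => ?_) i
      · exact ⟨0, by simp⟩
      · simpa using iv₂ _ hT₂ w hw i
  · intro V hV
    obtain ⟨T₁, hT₁, T₂, hT₂, rfl⟩ := (hPV V).1 hV
    exact zero_mem_PV (z₁ _ hT₁)
  · intro V hV v hv w hw _ _
    obtain ⟨T₁, hT₁, T₂, hT₂, rfl⟩ := (hPV V).1 hV
    have p1 : ∀ v ∈ T₁, ∀ w ∈ T₁, 0 ≤ v ⬝ᵥ M₁.mulVec w := by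
      intro v hv w hw
      by_cases h : v = 0
      · simp [h]
      by_cases h' : w = 0
      · simp [h']
      exact sc₁ _ hT₁ v hv w hw h h'
    have p2 : ∀ v ∈ T₂, ∀ w ∈ T₂, 0 ≤ v ⬝ᵥ M₂.mulVec w := by
      intro v hv w hw
      by_cases h : v = 0
      · simp [h]
      by_cases h' : w = 0
      · simp [h']
      exact sc₂ _ hT₂ v hv w hw h h'
    rw [hM]
    rcases mem_PV.1 hv with ⟨v, hv', rfl⟩ | ⟨v, hv', rfl⟩ <;>
      rcases mem_PV.1 hw with ⟨w, hw', rfl⟩ | ⟨w, hw', rfl⟩ <;> rw [block_mulVec]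
    · simpa using p1 v hv' w hw'
    · simp
    · simp
    · simpa using p2 v hv' w hw'

end
end
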